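/- arXiv:1507.07643 — 11 statements merged into one kernel-verified Lean document; each statement's English description precedes it below -/
import Mathlib

section
/- Let A be a locally C*-algebra with defining monotone family of C*-seminorms (p_λ)_{λ∈Λ}. Then there exist a locally Hilbert space H = ⋃_{λ∈Λ} H_λ over the same directed poset Λ and a map φ : A → B_loc(H) that is linear, multiplicative (φ(ab) = φ(a) ∘ φ(b)), star-preserving (φ(a*) = φ(a)*), injective, and satisfies ‖φ(a)|_{H_λ}‖ = p_λ(a) for all a ∈ A and λ ∈ Λ; in particular φ is a faithful coherent *-representation of A on H. -/
open scoped InnerProductSpace ComplexOrder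

noncomputable section

universe u v w

/-- A locally Hilbert space structure over the directed poset `Λ` on the
inner product space `H`: a monotone family of complete subspaces whose union is `H`. -/
structure LocallyHilbert (Λ : Type v) [PartialOrder Λ] (H : Type u)
    [NormedAddCommGroup H] [InnerProductSpace ℂ H] : Type (max u v) where
  E : Λ → Submodule ℂ H
  mono : Monotone E
  isComplete : ∀ lam : Λ, IsComplete (E lam : Set H)
  exhaustive : ∀ h : H, ∃ lam : Λ, h ∈ E lam

/-- A bundled locally Hilbert space over `Λ`. -/
structure LocHilbertBundle (Λ : Type v) [PartialOrder Λ] : Type (max (u + 1) v) where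
  carrier : Type u
  [ngroup : NormedAddCommGroup carrier]
  [ips : InnerProductSpace ℂ carrier]
  str : LocallyHilbert Λ carrier

attribute [instance] LocHilbertBundle.ngroup LocHilbertBundle.ips

variable {Λ : Type v} [PartialOrder Λ]
variable {H : Type u} [NormedAddCommGroup H] [InnerProductSpace ℂ H]
variable {K : Type w} [NormedAddCommGroup K] [InnerProductSpace ℂ K]

/-- `T : H → K` is a locally bounded operator: it maps each `H_λ` into `K_λ`, boundedly,
and (equivalently to the usual formulation) the adjoints of its restrictions are
compatible, i.e. for every `k ∈ K_λ` the functional `h ↦ ⟪T h, k⟫` is represented by a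
vector of `H_λ`. -/
structure IsLocallyBounded (hH : LocallyHilbert Λ H) (hK : LocallyHilbert Λ K)
    (T : H →ₗ[ℂ] K) : Prop where
  maps_mem : ∀ lam : Λ, ∀ h ∈ hH.E lam, T h ∈ hK.E lam
  bound : ∀ lam : Λ, ∃ C : ℝ, ∀ h ∈ hH.E lam, ‖T h‖ ≤ C * ‖h‖
  adjoint_mem : ∀ lam : Λ, ∀ k ∈ hK.E lam, ∃ v ∈ hH.E lam,
    ∀ h : H, ⟪T h, k⟫_ℂ = ⟪h, v⟫_ℂ

/-- `S` is the (formal) adjoint of `T`. -/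
def IsLAdjoint (T : H →ₗ[ℂ] K) (S : K →ₗ[ℂ] H) : Prop :=
  ∀ (h : H) (k : K), ⟪T h, k⟫_ℂ = ⟪h, S k⟫_ℂ

/-- The operator norm of the restriction of `T` to the submodule `p`. -/
def restNorm (p : Submodule ℂ H) (T : H →ₗ[ℂ] K) : ℝ :=
  sInf {C : ℝ | 0 ≤ C ∧ ∀ h ∈ p, ‖T h‖ ≤ C * ‖h‖}

/-- Positive semidefiniteness of a kernel with values locally bounded operators. -/
def IsPSDKernel {X : Type*} (k : X → X → (H →ₗ[ℂ] H)) : Prop :=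
  ∀ (n : ℕ) (x : Fin n → X) (h : Fin n → H),
    0 ≤ ∑ i, ∑ j, ⟪h i, k (x i) (x j) (h j)⟫_ℂ


universe x

/-- A locally C*-algebra structure on the complex associative `*`-algebra `A`: a
monotone family of C*-seminorms indexed by a directed poset `I`, which separates the
points of `A` (Hausdorff) and for which `A` is complete; completeness is expressed via
Cauchy filters for the family of seminorms. -/
structure LocallyCStar (I : Type x) [Preorder I] (A : Type w)
    [Ring A] [StarRing A] [Algebra ℂ A] [StarModule ℂ A] : Type (max w x) where
  p : I → A → ℝ
  nonneg : ∀ (i : I) (a : A), 0 ≤ p i a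
  add_le : ∀ (i : I) (a b : A), p i (a + b) ≤ p i a + p i b
  smul_eq : ∀ (i : I) (c : ℂ) (a : A), p i (c • a) = ‖c‖ * p i a
  mul_le : ∀ (i : I) (a b : A), p i (a * b) ≤ p i a * p i b
  star_eq : ∀ (i : I) (a : A), p i (star a) = p i a
  cstar : ∀ (i : I) (a : A), p i (star a * a) = p i a ^ 2
  mono : ∀ ⦃i j : I⦄, i ≤ j → ∀ a : A, p i a ≤ p j a
  separating : ∀ a : A, (∀ i : I, p i a = 0) → a = 0
  complete : ∀ F : Filter A, F.NeBot →
    (∀ (i : I) (ε : ℝ), 0 < ε → ∃ s ∈ F, ∀ a ∈ s, ∀ b ∈ s, p i (a - b) < ε) →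
    ∃ x : A, ∀ (i : I) (ε : ℝ), 0 < ε → {a : A | p i (a - x) < ε} ∈ F

open scoped ComplexStarModule

/-- In a unital C*-algebra, for every `a` there is a positive linear functional `f` with `f 1 ≤ 1`
that attains the value `‖a‖ ^ 2` at `star a * a`. -/
theorem CStarAlgebra.exists_positiveLinearMap_apply_star_mul_self {B : Type*} [CStarAlgebra B]
    [PartialOrder B] [StarOrderedRing B] (a : B) :
    ∃ f : B →ₚ[ℂ] ℂ, (f 1).re ≤ 1 ∧ f (star a * a) = (‖a‖ : ℂ) ^ 2 := by
  rcases eq_or_ne a 0 with rfl | ha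
  · exact ⟨0, by simp, by simp⟩
  have : Nontrivial B := ⟨a, 0, ha⟩
  set b : B := star a * a with hb
  have hb0 : 0 ≤ b := star_mul_self_nonneg a
  have hbn : ‖b‖ = ‖a‖ ^ 2 := by rw [hb, CStarRing.norm_star_mul_self, sq]
  obtain ⟨g, hg1, hg⟩ := exists_dual_vector'' ℝ (algebraMap ℝ B ‖b‖ + b)
  have hgle (x : B) : g x ≤ ‖x‖ :=
    (le_abs_self _).trans ((g.le_opNorm x).trans (mul_le_of_le_one_left (norm_nonneg _) hg1))
  have halg (r : ℝ) : g (algebraMap ℝ B r) = r * g 1 := by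
    rw [Algebra.algebraMap_eq_smul_one, map_smul, smul_eq_mul]
  have hbpos : 0 < ‖b‖ := by rw [hbn]; positivity
  have hnorm : 2 * ‖b‖ ≤ ‖algebraMap ℝ B ‖b‖ + b‖ := by
    set c := ‖algebraMap ℝ B ‖b‖ + b‖ with hc
    have h0 : 0 ≤ algebraMap ℝ B ‖b‖ := algebraMap_nonneg B (norm_nonneg b)
    have h1 : algebraMap ℝ B ‖b‖ + b ≤ algebraMap ℝ B c :=
      IsSelfAdjoint.le_algebraMap_norm_self (.of_nonneg (add_nonneg h0 hb0))
    have h2 : ‖b‖ ≤ c := by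
      have := CStarAlgebra.norm_le_norm_of_nonneg_of_le h0 (le_add_of_nonneg_right hb0)
      simpa [norm_algebraMap'] using this
    have h3 : ‖b‖ ≤ c - ‖b‖ := by
      rw [CStarAlgebra.norm_le_iff_le_algebraMap b (sub_nonneg.2 h2) hb0, map_sub, le_sub_iff_add_le]
      rwa [add_comm]
    linarith
  have hg1' : g 1 ≤ 1 := by simpa using hgle 1
  have hgb : g b ≤ ‖b‖ := hgle b
  have hsum : 2 * ‖b‖ ≤ ‖b‖ * g 1 + g b := by
    have : g (algebraMap ℝ B ‖b‖ + b) = ‖algebraMap ℝ B ‖b‖ + b‖ := hg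
    rw [map_add, halg] at this
    linarith
  have hg_one : g 1 = 1 := by nlinarith
  have hg_b : g b = ‖b‖ := by nlinarith
  have hpos (h : B) (hh : 0 ≤ h) : 0 ≤ g h := by
    have h1 : h ≤ algebraMap ℝ B ‖h‖ := IsSelfAdjoint.le_algebraMap_norm_self (.of_nonneg hh)
    have h2 : ‖algebraMap ℝ B ‖h‖ - h‖ ≤ ‖h‖ := by
      rw [CStarAlgebra.norm_le_iff_le_algebraMap _ (norm_nonneg h) (sub_nonneg.2 h1)]
      exact sub_le_self _ hh
    have h3 := (hgle _).trans h2
    rw [map_sub, halg, hg_one] at h3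
    linarith
  let fr : Module.Dual ℝ B :=
    (g : B →ₗ[ℝ] ℝ) ∘ₗ (selfAdjoint.submodule ℝ B).subtype ∘ₗ (realPart (A := B))
  have hfr (x : B) : fr x = g (ℜ x : B) := rfl
  have hsa (x : B) (hx : IsSelfAdjoint x) : fr.extendRCLike (𝕜 := ℂ) x = (g x : ℂ) := by
    rw [Module.Dual.extendRCLike_apply, hfr, hfr, hx.coe_realPart]
    have : ℜ ((RCLike.I : ℂ) • x) = -ℑ x := realPart_I_smul x
    rw [this, hx.imaginaryPart]
    simp
  refine ⟨PositiveLinearMap.mk₀ (fr.extendRCLike (𝕜 := ℂ)) fun x hx => ?_, ?_, ?_⟩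
  · rw [hsa x (.of_nonneg hx)]
    exact_mod_cast hpos x hx
  · change (fr.extendRCLike (𝕜 := ℂ) 1).re ≤ 1
    rw [hsa 1 (.one B), hg_one]
    simp
  · change fr.extendRCLike (𝕜 := ℂ) b = _
    rw [hsa b (.of_nonneg hb0), hg_b, hbn]
    simp

/-- For every element `a` of a unital C*-algebra there is a `*`-representation on a Hilbert space
that preserves the norm of `a`. -/
theorem CStarAlgebra.exists_rep_norm_eq {B : Type w} [CStarAlgebra B] (a : B) :
    ∃ (V : Type w) (_ : NormedAddCommGroup V) (_ : InnerProductSpace ℂ V) (_ : CompleteSpace V)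
      (π : B →⋆ₐ[ℂ] (V →L[ℂ] V)), ‖π a‖ = ‖a‖ := by
  let := CStarAlgebra.spectralOrder B
  have := CStarAlgebra.spectralOrderedRing B
  obtain ⟨f, hf1, hfa⟩ := CStarAlgebra.exists_positiveLinearMap_apply_star_mul_self a
  refine ⟨f.GNS, inferInstance, inferInstance, inferInstance, f.gnsStarAlgHom,
    le_antisymm (NonUnitalStarAlgHom.norm_apply_le f.gnsStarAlgHom a) ?_⟩
  have h1 : ‖f.toPreGNS 1‖ ≤ 1 := by
    rw [PositiveLinearMap.preGNS_norm_def]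
    simpa using hf1
  have h2 : ‖f.toPreGNS a‖ = ‖a‖ := by
    rw [PositiveLinearMap.preGNS_norm_def, PositiveLinearMap.ofPreGNS_toPreGNS, hfa,
      ← Complex.ofReal_pow, Complex.ofReal_re, Real.sqrt_sq (norm_nonneg a)]
  have h3 : f.gnsStarAlgHom a (f.toPreGNS 1 : f.GNS) = (f.toPreGNS a : f.GNS) := by
    change f.gnsNonUnitalStarAlgHom a _ = _
    simp
  calc ‖a‖ = ‖f.gnsStarAlgHom a (f.toPreGNS 1 : f.GNS)‖ := by
        rw [h3, UniformSpace.Completion.norm_coe, h2]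
    _ ≤ ‖f.gnsStarAlgHom a‖ * ‖(f.toPreGNS 1 : f.GNS)‖ := ContinuousLinearMap.le_opNorm _ _
    _ ≤ ‖f.gnsStarAlgHom a‖ :=
        mul_le_of_le_one_right (norm_nonneg _) (by rwa [UniformSpace.Completion.norm_coe])

namespace UniformSpace.Completion

variable {A : Type*} [SeminormedRing A] [StarRing A] [NormedStarGroup A]

instance instStarCompletion : Star (Completion A) where
  star := Completion.map star

theorem star_coe (a : A) : star (a : Completion A) = (star a : A) :=
  map_coe (star_isometry (E := A)).uniformContinuous a

instance : ContinuousStar (Completion A) where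
  continuous_star := continuous_map

instance : StarRing (Completion A) where
  star_involutive x := by
    induction x using induction_on with
    | hp => exact isClosed_eq (by fun_prop) (by fun_prop)
    | ih x => simp [star_coe]
  star_mul x y := by
    induction x, y using induction_on₂ with
    | hp => exact isClosed_eq (by fun_prop) (by fun_prop)
    | ih x y => simp [star_coe, ← coe_mul]
  star_add x y := by
    induction x, y using induction_on₂ with
    | hp => exact isClosed_eq (by fun_prop) (by fun_prop)
    | ih x y => simp [star_coe, ← coe_add]

theorem cstarRing (h : ∀ a : A, ‖a‖ * ‖a‖ ≤ ‖star a * a‖) : CStarRing (Completion A) where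
  norm_mul_self_le x := by
    induction x using induction_on with
    | hp => exact isClosed_le (by fun_prop) (by fun_prop)
    | ih x => simpa [star_coe, ← coe_mul] using h x

variable [NormedAlgebra ℂ A]

instance : NormedAlgebra ℂ (Completion A) where
  norm_smul_le := norm_smul_le

instance [StarModule ℂ A] : StarModule ℂ (Completion A) where
  star_smul c x := by
    induction x using induction_on with
    | hp =>
      exact isClosed_eq (continuous_star.comp (continuous_const_smul c))
        ((continuous_const_smul (star c)).comp continuous_star)
    | ih x => rw [← coe_smul, star_coe, star_coe, star_smul, coe_smul]

/-- The completion of a unital `*`-algebra with respect to a C*-seminorm. -/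
abbrev cstarAlgebra [StarModule ℂ A]
    (h : ∀ a : A, ‖a‖ * ‖a‖ ≤ ‖star a * a‖) : CStarAlgebra (Completion A) where
  __ := cstarRing h

end UniformSpace.Completion

/-- Given a C*-seminorm `p` on a unital `*`-algebra and an element `a`, there is a
`*`-representation on a Hilbert space dominated by `p` whose norm at `a` is `p a`. -/
theorem exists_rep_le_seminorm_eq {A : Type w} [Ring A] [StarRing A] [Algebra ℂ A]
    [StarModule ℂ A] (p : A → ℝ) (add_le : ∀ a b, p (a + b) ≤ p a + p b)
    (smul_eq : ∀ (c : ℂ) a, p (c • a) = ‖c‖ * p a) (mul_le : ∀ a b, p (a * b) ≤ p a * p b)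
    (star_eq : ∀ a, p (star a) = p a) (cstar : ∀ a, p (star a * a) = p a ^ 2) (a : A) :
    ∃ (V : Type w) (_ : NormedAddCommGroup V) (_ : InnerProductSpace ℂ V) (_ : CompleteSpace V)
      (π : A →⋆ₐ[ℂ] (V →L[ℂ] V)), (∀ x, ‖π x‖ ≤ p x) ∧ ‖π a‖ = p a := by
  let q : RingSeminorm A :=
    { toFun := p
      map_zero' := by simpa using smul_eq 0 0
      add_le' := add_le
      neg' := fun x => by simpa using smul_eq (-1) x
      mul_le' := mul_le }
  let : SeminormedRing A := q.toSeminormedRing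
  have hnorm (x : A) : ‖x‖ = p x := rfl
  let : NormedAlgebra ℂ A := { ‹Algebra ℂ A› with norm_smul_le := fun c x => (smul_eq c x).le }
  have : NormedStarGroup A := ⟨fun x => (star_eq x).le⟩
  let : CStarAlgebra (UniformSpace.Completion A) :=
    UniformSpace.Completion.cstarAlgebra fun x => by
      rw [hnorm, hnorm, cstar, sq]
  let j : A →⋆ₐ[ℂ] UniformSpace.Completion A :=
    { (UniformSpace.Completion.coeRingHom : A →+* UniformSpace.Completion A) with
      commutes' := fun _ => rfl
      map_star' := fun x => (UniformSpace.Completion.star_coe x).symm }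
  have hj (x : A) : ‖j x‖ = p x := UniformSpace.Completion.norm_coe x
  obtain ⟨V, i1, i2, i3, π, hπ⟩ := CStarAlgebra.exists_rep_norm_eq (j a)
  exact ⟨V, i1, i2, i3, π.comp j,
    fun x => (NonUnitalStarAlgHom.norm_apply_le π (j x)).trans (hj x).le, hπ.trans (hj a)⟩

section LevelSum

variable {ι : Type*} (d : ι → Λ)
variable (V : ι → Type*) [∀ i, NormedAddCommGroup (V i)] [∀ i, InnerProductSpace ℂ (V i)]

/-- The vectors of the Hilbert sum of `V` supported on the indices of level at most `lam`. -/
def levelSubmodule (lam : Λ) : Submodule ℂ (lp V 2) where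
  carrier := {f | ∀ i, ¬ d i ≤ lam → f i = 0}
  add_mem' {f g} hf hg i hi := by simp [hf i hi, hg i hi]
  zero_mem' i _ := by simp
  smul_mem' c f hf i hi := by simp [hf i hi]

theorem levelSubmodule_mono : Monotone (levelSubmodule d V) :=
  fun _ _ h _ hf i hi => hf i fun h' => hi (h'.trans h)

theorem isClosed_levelSubmodule (lam : Λ) : IsClosed (levelSubmodule d V lam : Set (lp V 2)) := by
  have : (levelSubmodule d V lam : Set (lp V 2)) =
      ⋂ i, ⋂ (_ : ¬ d i ≤ lam), {f : lp V 2 | f i = 0} := by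
    ext f
    simp only [Set.mem_iInter]
    rfl
  rw [this]
  refine isClosed_iInter fun i => isClosed_iInter fun _ => isClosed_eq ?_ continuous_const
  exact (continuous_apply i).comp (lp.uniformContinuous_coe (E := V) (p := 2)).continuous

variable {d V} in
theorem norm_apply_le_of_mem_levelSubmodule {T : ∀ i, V i →L[ℂ] V i} {lam : Λ} {C : ℝ}
    (hT : ∀ i, d i ≤ lam → ‖T i‖ ≤ C) {f : lp V 2} (hf : f ∈ levelSubmodule d V lam) (i : ι) :
    ‖T i (f i)‖ ≤ ‖(((|C| : ℝ) : ℂ) • f) i‖ := by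
  by_cases hi : d i ≤ lam
  · calc ‖T i (f i)‖ ≤ ‖T i‖ * ‖f i‖ := (T i).le_opNorm _
      _ ≤ |C| * ‖f i‖ := by
        gcongr
        exact (hT i hi).trans (le_abs_self C)
      _ = _ := by rw [lp.coeFn_smul, Pi.smul_apply, norm_smul, Complex.norm_real, Real.norm_eq_abs,
        abs_abs]
  · simp [hf i hi]

variable [IsDirected Λ (· ≤ ·)] [Nonempty Λ]

/-- The vectors of the Hilbert sum of `V` supported on the indices of bounded level. -/
def boundedLevelSubmodule : Submodule ℂ (lp V 2) where
  carrier := {f | ∃ lam, f ∈ levelSubmodule d V lam}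
  add_mem' := by
    rintro f g ⟨l, hf⟩ ⟨m, hg⟩
    obtain ⟨n, hl, hm⟩ := exists_ge_ge l m
    exact ⟨n, add_mem (levelSubmodule_mono d V hl hf) (levelSubmodule_mono d V hm hg)⟩
  zero_mem' := ⟨Classical.arbitrary Λ, zero_mem _⟩
  smul_mem' := fun c _ ⟨l, hf⟩ => ⟨l, Submodule.smul_mem _ c hf⟩

/-- The locally Hilbert space of vectors of bounded level in a Hilbert sum. -/
def levelLocallyHilbert [∀ i, CompleteSpace (V i)] :
    LocallyHilbert Λ (boundedLevelSubmodule d V) where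
  E lam := (levelSubmodule d V lam).comap (boundedLevelSubmodule d V).subtype
  mono _ _ h := Submodule.comap_mono (levelSubmodule_mono d V h)
  isComplete lam := by
    rw [← isComplete_image_iff isometry_subtype_coe.isUniformInducing]
    have h := (isClosed_levelSubmodule d V lam).isComplete
    have himage : ((↑) : boundedLevelSubmodule d V → lp V 2) ''
        ((levelSubmodule d V lam).comap (boundedLevelSubmodule d V).subtype : Set _) =
        levelSubmodule d V lam := by
      ext f
      constructor
      · rintro ⟨g, hg, rfl⟩
        exact hg
      · exact fun hf => ⟨⟨f, lam, hf⟩, hf, rfl⟩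
    rw [← himage] at h
    exact h
  exhaustive h := h.2

variable {d V}

theorem mem_levelLocallyHilbert_iff [∀ i, CompleteSpace (V i)] {lam : Λ}
    {f : boundedLevelSubmodule d V} :
    f ∈ (levelLocallyHilbert d V).E lam ↔ ∀ i, ¬ d i ≤ lam → f.1 i = 0 :=
  Iff.rfl

/-- The diagonal operator on the vectors of bounded level given by a family of operators that is
uniformly bounded on each level. -/
def levelDiagonal (T : ∀ i, V i →L[ℂ] V i) (hT : ∀ lam, ∃ C, ∀ i, d i ≤ lam → ‖T i‖ ≤ C) :
    boundedLevelSubmodule d V →ₗ[ℂ] boundedLevelSubmodule d V where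
  toFun f :=
    ⟨⟨fun i => T i (f.1 i), by
      obtain ⟨lam, hf⟩ := f.2
      obtain ⟨C, hC⟩ := hT lam
      exact (lp.memℓp (((|C| : ℝ) : ℂ) • f.1)).mono' (norm_apply_le_of_mem_levelSubmodule hC hf)⟩, by
      obtain ⟨lam, hf⟩ := f.2
      exact ⟨lam, fun i hi => by simp [hf i hi]⟩⟩
  map_add' f g := by
    ext i
    exact map_add (T i) _ _
  map_smul' c f := by
    ext i
    exact map_smul (T i) c _

@[simp]
theorem levelDiagonal_apply (T : ∀ i, V i →L[ℂ] V i)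
    (hT : ∀ lam, ∃ C, ∀ i, d i ≤ lam → ‖T i‖ ≤ C) (f : boundedLevelSubmodule d V) (i : ι) :
    (levelDiagonal T hT f).1 i = T i (f.1 i) :=
  rfl

theorem isLAdjoint_levelDiagonal {S T : ∀ i, V i →L[ℂ] V i}
    (hS : ∀ lam, ∃ C, ∀ i, d i ≤ lam → ‖S i‖ ≤ C) (hT : ∀ lam, ∃ C, ∀ i, d i ≤ lam → ‖T i‖ ≤ C)
    (hST : ∀ i x y, ⟪T i x, y⟫_ℂ = ⟪x, S i y⟫_ℂ) :
    IsLAdjoint (levelDiagonal T hT) (levelDiagonal S hS) := by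
  intro h k
  change ⟪(levelDiagonal T hT h).1, k.1⟫_ℂ = ⟪h.1, (levelDiagonal S hS k).1⟫_ℂ
  simp [lp.inner_eq_tsum, hST]

variable [∀ i, CompleteSpace (V i)]

theorem levelDiagonal_mem {T : ∀ i, V i →L[ℂ] V i}
    (hT : ∀ lam, ∃ C, ∀ i, d i ≤ lam → ‖T i‖ ≤ C) {lam : Λ} {f : boundedLevelSubmodule d V}
    (hf : f ∈ (levelLocallyHilbert d V).E lam) :
    levelDiagonal T hT f ∈ (levelLocallyHilbert d V).E lam :=
  mem_levelLocallyHilbert_iff.2 fun i hi => by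
    simp [mem_levelLocallyHilbert_iff.1 hf i hi]

theorem norm_levelDiagonal_le {T : ∀ i, V i →L[ℂ] V i}
    (hT : ∀ lam, ∃ C, ∀ i, d i ≤ lam → ‖T i‖ ≤ C) {lam : Λ} {C : ℝ}
    (hC : ∀ i, d i ≤ lam → ‖T i‖ ≤ C) (hC0 : 0 ≤ C) {f : boundedLevelSubmodule d V}
    (hf : f ∈ (levelLocallyHilbert d V).E lam) : ‖levelDiagonal T hT f‖ ≤ C * ‖f‖ := by
  have h := lp.norm_mono two_ne_zero (x := (levelDiagonal T hT f).1) (y := ((|C| : ℝ) : ℂ) • f.1)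
    (norm_apply_le_of_mem_levelSubmodule hC hf)
  rwa [norm_smul, Complex.norm_real, Real.norm_eq_abs, abs_abs, abs_of_nonneg hC0] at h

theorem isLocallyBounded_levelDiagonal {S T : ∀ i, V i →L[ℂ] V i}
    (hS : ∀ lam, ∃ C, ∀ i, d i ≤ lam → ‖S i‖ ≤ C) (hT : ∀ lam, ∃ C, ∀ i, d i ≤ lam → ‖T i‖ ≤ C)
    (hST : ∀ i x y, ⟪T i x, y⟫_ℂ = ⟪x, S i y⟫_ℂ) :
    IsLocallyBounded (levelLocallyHilbert d V) (levelLocallyHilbert d V) (levelDiagonal T hT) where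
  maps_mem _ _ hf := levelDiagonal_mem hT hf
  bound lam := by
    obtain ⟨C, hC⟩ := hT lam
    exact ⟨|C|, fun f hf => norm_levelDiagonal_le hT
      (fun i hi => (hC i hi).trans (le_abs_self C)) (abs_nonneg C) hf⟩
  adjoint_mem _ k hk :=
    ⟨levelDiagonal S hS k, levelDiagonal_mem hS hk,
      fun h => isLAdjoint_levelDiagonal hS hT hST h k⟩

theorem restNorm_levelDiagonal {T : ∀ i, V i →L[ℂ] V i}
    (hT : ∀ lam, ∃ C, ∀ i, d i ≤ lam → ‖T i‖ ≤ C) {lam : Λ} {C : ℝ}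
    (hC : ∀ i, d i ≤ lam → ‖T i‖ ≤ C) {i : ι} (hi : d i ≤ lam) (hiC : ‖T i‖ = C) :
    restNorm ((levelLocallyHilbert d V).E lam) (levelDiagonal T hT) = C := by
  classical
  have hC0 : 0 ≤ C := hiC ▸ norm_nonneg _
  refine IsLeast.csInf_eq ⟨⟨hC0, fun f hf => norm_levelDiagonal_le hT hC hC0 hf⟩, ?_⟩
  rintro D ⟨hD0, hD⟩
  rw [← hiC]
  refine ContinuousLinearMap.opNorm_le_bound _ hD0 fun v => ?_
  have hmem : lp.single 2 i v ∈ levelSubmodule d V lam := fun j hj =>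
    lp.single_apply_ne 2 i v fun h => hj (h ▸ hi)
  have h := hD ⟨lp.single 2 i v, lam, hmem⟩ hmem
  have h1 := lp.norm_apply_le_norm two_ne_zero
    (levelDiagonal T hT ⟨lp.single 2 i v, lam, hmem⟩).1 i
  rw [levelDiagonal_apply, lp.single_apply_self] at h1
  calc ‖T i v‖ ≤ _ := h1
    _ ≤ D * ‖lp.single 2 i v‖ := h
    _ = D * ‖v‖ := by rw [lp.norm_single two_pos]

end LevelSum

/-- Gelfand–Naimark theorem for locally C*-algebras: every locally
C*-algebra `A`, with C*-seminorms `(p_λ)_{λ∈Λ}`, admits a faithful coherent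
`*`-representation `φ` on a locally Hilbert space `H = ⋃_{λ∈Λ} H_λ` over the same
directed poset, which moreover satisfies `‖φ(a)|_{H_λ}‖ = p_λ(a)`. -/
theorem locallyCStar_gelfand_naimark
    {Λ : Type v} [PartialOrder Λ] [Nonempty Λ] [IsDirected Λ (· ≤ ·)]
    {A : Type w} [Ring A] [StarRing A] [Algebra ℂ A] [StarModule ℂ A]
    (pA : LocallyCStar Λ A) :
    ∃ (Hb : LocHilbertBundle.{max v w, v} Λ)
      (φ : A →ₗ[ℂ] (Hb.carrier →ₗ[ℂ] Hb.carrier)),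
      (∀ a : A, IsLocallyBounded Hb.str Hb.str (φ a)) ∧
      (∀ a b : A, φ (a * b) = (φ a) ∘ₗ (φ b)) ∧
      (∀ a : A, IsLAdjoint (φ a) (φ (star a))) ∧
      Function.Injective φ ∧
      (∀ (a : A) (lam : Λ), restNorm (Hb.str.E lam) (φ a) = pA.p lam a) := by
  choose V i1 i2 i3 π hle heq using fun i : Λ × A =>
    exists_rep_le_seminorm_eq (pA.p i.1) (pA.add_le i.1) (pA.smul_eq i.1) (pA.mul_le i.1)
      (pA.star_eq i.1) (pA.cstar i.1) i.2
  have hC (a : A) (lam : Λ) (i : Λ × A) (hi : i.1 ≤ lam) : ‖π i a‖ ≤ pA.p lam a :=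
    (hle i a).trans (pA.mono hi a)
  have hT (a : A) (lam : Λ) : ∃ C, ∀ i : Λ × A, i.1 ≤ lam → ‖π i a‖ ≤ C := ⟨_, hC a lam⟩
  have hadj (a : A) (i : Λ × A) (x y : V i) : ⟪π i a x, y⟫_ℂ = ⟪x, π i (star a) y⟫_ℂ := by
    rw [map_star, ContinuousLinearMap.star_eq_adjoint, ContinuousLinearMap.adjoint_inner_right]
  let φ : A →ₗ[ℂ] (boundedLevelSubmodule Prod.fst V →ₗ[ℂ] boundedLevelSubmodule Prod.fst V) :=
    { toFun a := levelDiagonal (fun i => π i a) (hT a)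
      map_add' a b := by
        ext f i
        simp
      map_smul' c a := by
        ext f i
        simp }
  have hrest (a : A) (lam : Λ) :
      restNorm ((levelLocallyHilbert Prod.fst V).E lam) (φ a) = pA.p lam a :=
    restNorm_levelDiagonal (hT a) (hC a lam) (i := (lam, a)) le_rfl (heq (lam, a))
  refine ⟨⟨boundedLevelSubmodule Prod.fst V, levelLocallyHilbert Prod.fst V⟩, φ,
    fun a => isLocallyBounded_levelDiagonal (hT (star a)) (hT a) (hadj a), fun a b => ?_,
    fun a => isLAdjoint_levelDiagonal (hT (star a)) (hT a) (hadj a), ?_, hrest⟩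
  · refine LinearMap.ext fun f => Subtype.ext (lp.ext (funext fun i => ?_))
    simp [φ]
  · rw [injective_iff_map_eq_zero]
    intro a ha
    refine pA.separating a fun lam => ?_
    rw [← hrest, ha, ← map_zero φ, hrest]
    simpa using pA.smul_eq lam 0 0
end
end

section
/- Let H = ⋃_{λ∈Λ} H_λ and G = ⋃_{α∈A'} G_α be locally Hilbert spaces. Then: (i) there is a unique inner product on the algebraic tensor product H ⊗ G over ℂ satisfying ⟨h⊗g, h'⊗g'⟩ = ⟨h,h'⟩_H · ⟨g,g'⟩_G on elementary tensors, and this inner product is positive definite; (ii) for (λ,α) ≤ (μ,β) in the product order on Λ×A', the inclusion of H_λ ⊗ G_α into H_μ ⊗ G_β is isometric for the restricted inner products; (iii) denoting by H_λ ⊗̂ G_α the closure of H_λ ⊗ G_α in the completion of H ⊗ G, the family (H_λ ⊗̂ G_α)_{(λ,α)∈Λ×A'} is monotone and each member is complete, so that its union H ⊗_loc G := ⋃_{(λ,α)} H_λ ⊗̂ G_α is a locally Hilbert space over the directed product poset Λ×A' containing H ⊗ G. -/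
open scoped InnerProductSpace ComplexOrder

noncomputable section

universe u v w

variable {Λ : Type v} [PartialOrder Λ]
variable {H : Type u} [NormedAddCommGroup H] [InnerProductSpace ℂ H]
variable {K : Type w} [NormedAddCommGroup K] [InnerProductSpace ℂ K]

open scoped TensorProduct

universe u₁ u₂ v₁ v₂

/-- A sesquilinear form on the algebraic tensor product `H ⊗ G` (conjugate-linear in
the first variable, by conjugate symmetry) which on elementary tensors is the product
of the inner products. -/
def IsTensorInner (H : Type u₁) (G : Type u₂)
    [NormedAddCommGroup H] [InnerProductSpace ℂ H]
    [NormedAddCommGroup G] [InnerProductSpace ℂ G]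
    (ip : TensorProduct ℂ H G → TensorProduct ℂ H G → ℂ) : Prop :=
  (∀ x y z : TensorProduct ℂ H G, ip (x + y) z = ip x z + ip y z) ∧
  (∀ x y z : TensorProduct ℂ H G, ip x (y + z) = ip x y + ip x z) ∧
  (∀ (c : ℂ) (x y : TensorProduct ℂ H G), ip x (c • y) = c * ip x y) ∧
  (∀ x y : TensorProduct ℂ H G, ip y x = starRingEnd ℂ (ip x y)) ∧
  (∀ (h h' : H) (g g' : G), ip (h ⊗ₜ[ℂ] g) (h' ⊗ₜ[ℂ] g') = ⟪h, h'⟫_ℂ * ⟪g, g'⟫_ℂ)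

namespace IsTensorInner

variable {V : Type u₁} {W : Type u₂} [NormedAddCommGroup V] [InnerProductSpace ℂ V]
  [NormedAddCommGroup W] [InnerProductSpace ℂ W]

theorem inner (V : Type u₁) (W : Type u₂) [NormedAddCommGroup V] [InnerProductSpace ℂ V]
    [NormedAddCommGroup W] [InnerProductSpace ℂ W] :
    IsTensorInner V W fun x y => ⟪x, y⟫_ℂ :=
  ⟨inner_add_left, inner_add_right, fun c x y => inner_smul_right x y c,
    fun x y => (inner_conj_symm y x).symm, fun h h' g g' => TensorProduct.inner_tmul ℂ h h' g g'⟩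

theorem eq_inner {ip : V ⊗[ℂ] W → V ⊗[ℂ] W → ℂ} (hip : IsTensorInner V W ip)
    (x y : V ⊗[ℂ] W) : ip x y = ⟪x, y⟫_ℂ := by
  obtain ⟨add_left, add_right, smul_right, conj_symm, tmul⟩ := hip
  have zero_right (z : V ⊗[ℂ] W) : ip z 0 = 0 := by simpa using smul_right 0 z 0
  have zero_left (z : V ⊗[ℂ] W) : ip 0 z = 0 := by rw [conj_symm z 0, zero_right, map_zero]
  induction x with
  | zero => simp [zero_left]
  | add a b ha hb => rw [add_left, ha, hb, inner_add_left]
  | tmul h g =>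
    induction y with
    | zero => simp [zero_right]
    | add a b ha hb => rw [add_right, ha, hb, inner_add_right]
    | tmul h' g' => rw [tmul, TensorProduct.inner_tmul]

end IsTensorInner

instance Prod.instIsDirected {α β : Type*} [LE α] [LE β] [IsDirected α (· ≤ ·)]
    [IsDirected β (· ≤ ·)] : IsDirected (α × β) (· ≤ ·) where
  directed p q := by
    obtain ⟨a, hpa, hqa⟩ := exists_ge_ge p.1 q.1
    obtain ⟨b, hpb, hqb⟩ := exists_ge_ge p.2 q.2
    exact ⟨(a, b), ⟨hpa, hpb⟩, ⟨hqa, hqb⟩⟩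

namespace LocallyHilbert

/-- The union of a directed family of closed subspaces of a Hilbert space. -/
def ofClosed {I : Type v} [PartialOrder I] [Nonempty I] [IsDirected I (· ≤ ·)]
    {C : Type u} [NormedAddCommGroup C] [InnerProductSpace ℂ C] [CompleteSpace C]
    (F : I → Submodule ℂ C) (hmono : Monotone F) (hclosed : ∀ i, IsClosed (F i : Set C)) :
    LocallyHilbert I ↥(⨆ i, F i) where
  E i := (F i).comap (⨆ i, F i).subtype
  mono _ _ hij := Submodule.comap_mono (hmono hij)
  isComplete i := by
    rw [← isComplete_image_iff isUniformEmbedding_subtype_val.isUniformInducing]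
    have himage : Subtype.val '' ((F i).comap (⨆ i, F i).subtype : Set ↥(⨆ i, F i)) = F i := by
      ext x
      exact ⟨by rintro ⟨y, hy, rfl⟩; exact hy, fun hx => ⟨⟨x, le_iSup F i hx⟩, hx, rfl⟩⟩
    rw [himage]
    exact (hclosed i).isComplete
  exhaustive h := (Submodule.mem_iSup_of_directed F hmono.directed_le).1 h.2

/-- The span of the elementary tensors of `V_i ⊗ W_a` inside `V ⊗ W`. -/
def tensorSpan {I : Type v₁} [PartialOrder I] {J : Type v₂} [PartialOrder J]
    {V : Type u₁} [NormedAddCommGroup V] [InnerProductSpace ℂ V]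
    {W : Type u₂} [NormedAddCommGroup W] [InnerProductSpace ℂ W]
    (hV : LocallyHilbert I V) (hW : LocallyHilbert J W) (p : I × J) : Submodule ℂ (V ⊗[ℂ] W) :=
  Submodule.span ℂ {t | ∃ h ∈ hV.E p.1, ∃ g ∈ hW.E p.2, h ⊗ₜ[ℂ] g = t}

section Tensor

variable {I : Type v₁} [PartialOrder I] {J : Type v₂} [PartialOrder J]
  {V : Type u₁} [NormedAddCommGroup V] [InnerProductSpace ℂ V]
  {W : Type u₂} [NormedAddCommGroup W] [InnerProductSpace ℂ W]
  (hV : LocallyHilbert I V) (hW : LocallyHilbert J W)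

theorem tensorSpan_mono : Monotone (hV.tensorSpan hW) := by
  rintro p q hpq
  refine Submodule.span_mono ?_
  rintro t ⟨h, hh, g, hg, rfl⟩
  exact ⟨h, hV.mono hpq.1 hh, g, hW.mono hpq.2 hg, rfl⟩

theorem iSup_tensorSpan : ⨆ p, hV.tensorSpan hW p = ⊤ := by
  rw [eq_top_iff, ← TensorProduct.span_tmul_eq_top, Submodule.span_le]
  rintro t ⟨h, g, rfl⟩
  obtain ⟨i, hi⟩ := hV.exhaustive h
  obtain ⟨a, ha⟩ := hW.exhaustive g
  exact Submodule.mem_iSup_of_mem (i, a) (Submodule.subset_span ⟨h, hi, g, ha, rfl⟩)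

theorem map_tensorSpan {M : Type*} [AddCommGroup M] [Module ℂ M] (f : V ⊗[ℂ] W →ₗ[ℂ] M)
    (p : I × J) : (hV.tensorSpan hW p).map f =
      Submodule.span ℂ {u | ∃ h ∈ hV.E p.1, ∃ g ∈ hW.E p.2, f (h ⊗ₜ[ℂ] g) = u} := by
  rw [tensorSpan, Submodule.map_span]
  congr 1
  ext u
  simp only [Set.mem_image, Set.mem_ofPred_eq]
  constructor
  · rintro ⟨_, ⟨h, hh, g, hg, rfl⟩, rfl⟩
    exact ⟨h, hh, g, hg, rfl⟩
  · rintro ⟨h, hh, g, hg, rfl⟩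
    exact ⟨_, ⟨h, hh, g, hg, rfl⟩, rfl⟩

/-- The closure of `V_i ⊗ W_a` in the completion of `V ⊗ W`. -/
def tensorClosure (p : I × J) : Submodule ℂ (UniformSpace.Completion (V ⊗[ℂ] W)) :=
  ((hV.tensorSpan hW p).map
    (UniformSpace.Completion.toComplₗᵢ (𝕜 := ℂ) (E := V ⊗[ℂ] W)).toLinearMap).topologicalClosure

theorem tensorClosure_mono : Monotone (hV.tensorClosure hW) := fun _ _ hpq =>
  Submodule.topologicalClosure_mono (Submodule.map_mono (hV.tensorSpan_mono hW hpq))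

theorem toCompl_mem_iSup_tensorClosure (x : V ⊗[ℂ] W) :
    UniformSpace.Completion.toComplₗᵢ (𝕜 := ℂ) x ∈ ⨆ p, hV.tensorClosure hW p := by
  have hx : UniformSpace.Completion.toComplₗᵢ (𝕜 := ℂ) x ∈ (⨆ p, hV.tensorSpan hW p).map
      (UniformSpace.Completion.toComplₗᵢ (𝕜 := ℂ) (E := V ⊗[ℂ] W)).toLinearMap :=
    Submodule.mem_map_of_mem (by simp [iSup_tensorSpan])
  rw [Submodule.map_iSup] at hx
  exact iSup_mono (fun _ => Submodule.le_topologicalClosure _) hx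

/-- The locally Hilbert space `V ⊗_loc W`. -/
def tensor [Nonempty I] [IsDirected I (· ≤ ·)] [Nonempty J] [IsDirected J (· ≤ ·)] :
    LocHilbertBundle.{max u₁ u₂, max v₁ v₂} (I × J) where
  carrier := ↥(⨆ p, hV.tensorClosure hW p)
  str := ofClosed (hV.tensorClosure hW) (hV.tensorClosure_mono hW)
    fun _ => Submodule.isClosed_topologicalClosure _

end Tensor

end LocallyHilbert

theorem Submodule.topologicalClosure_eq_comap_subtype {C : Type*} [NormedAddCommGroup C]
    [InnerProductSpace ℂ C] (U : Submodule ℂ C) (S : Submodule ℂ U) :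
    S.topologicalClosure = (S.map U.subtype).topologicalClosure.comap U.subtype := by
  ext x
  exact closure_subtype

/-- For locally Hilbert spaces `H = ⋃_{λ∈Λ} H_λ` and
`G = ⋃_{α∈A'} G_α`: (i) there is a unique inner product on `H ⊗ G` with
`⟨h⊗g, h'⊗g'⟩ = ⟨h,h'⟩⟨g,g'⟩`, and it is positive definite; (ii) the canonical maps
`H_λ ⊗ G_α → H ⊗ G` are isometric, so the inclusions `H_λ ⊗ G_α ⊆ H_μ ⊗ G_β` are
isometric; (iii) the closures `H_λ ⊗̂ G_α` (in the completion of `H ⊗ G`) form a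
monotone family of complete subspaces whose union `H ⊗_loc G` is a locally Hilbert
space over `Λ × A'` containing `H ⊗ G`. -/
theorem locallyHilbert_tensorProduct
    {Λ : Type v₁} [PartialOrder Λ] [Nonempty Λ] [IsDirected Λ (· ≤ ·)]
    {A' : Type v₂} [PartialOrder A'] [Nonempty A'] [IsDirected A' (· ≤ ·)]
    {H : Type u₁} [NormedAddCommGroup H] [InnerProductSpace ℂ H]
    {G : Type u₂} [NormedAddCommGroup G] [InnerProductSpace ℂ G]
    (hH : LocallyHilbert Λ H) (hG : LocallyHilbert A' G) :
    -- (i)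
    (∃! ip : TensorProduct ℂ H G → TensorProduct ℂ H G → ℂ,
      IsTensorInner H G ip ∧ (∀ x, 0 ≤ ip x x) ∧ (∀ x, ip x x = 0 → x = 0)) ∧
    -- (ii)
    (∀ ip : TensorProduct ℂ H G → TensorProduct ℂ H G → ℂ, IsTensorInner H G ip →
      ∀ (lam : Λ) (α : A')
        (ip' : TensorProduct ℂ (hH.E lam) (hG.E α) → TensorProduct ℂ (hH.E lam) (hG.E α) → ℂ),
        IsTensorInner (hH.E lam) (hG.E α) ip' →
        ∀ u v : TensorProduct ℂ (hH.E lam) (hG.E α),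
          ip' u v = ip (TensorProduct.map (hH.E lam).subtype (hG.E α).subtype u)
            (TensorProduct.map (hH.E lam).subtype (hG.E α).subtype v)) ∧
    -- (iii)
    (∀ ip : TensorProduct ℂ H G → TensorProduct ℂ H G → ℂ,
      IsTensorInner H G ip → (∀ x, 0 ≤ ip x x) → (∀ x, ip x x = 0 → x = 0) →
      ∃ (Pb : LocHilbertBundle.{max u₁ u₂, max v₁ v₂} (Λ × A'))
        (j : TensorProduct ℂ H G →ₗ[ℂ] Pb.carrier),
        Function.Injective j ∧
        (∀ x y : TensorProduct ℂ H G, ⟪j x, j y⟫_ℂ = ip x y) ∧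
        (∀ (lam : Λ) (α : A'),
          (Submodule.span ℂ
            {u : Pb.carrier | ∃ h ∈ hH.E lam, ∃ g ∈ hG.E α, j (h ⊗ₜ[ℂ] g) = u}).topologicalClosure
              = Pb.str.E (lam, α))) := by
  refine ⟨⟨fun x y => ⟪x, y⟫_ℂ, ⟨.inner H G, fun x => ?_, fun x hx => inner_self_eq_zero.1 hx⟩, ?_⟩,
    ?_, ?_⟩
  · have hnonneg : (0 : ℂ) ≤ (‖x‖ : ℂ) ^ 2 := mod_cast sq_nonneg ‖x‖
    exact hnonneg.trans_eq (inner_self_eq_norm_sq_to_K (𝕜 := ℂ) x).symm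
  · rintro ip ⟨hip, -⟩
    funext x y
    exact hip.eq_inner x y
  · intro ip hip lam α ip' hip' u v
    rw [hip.eq_inner, hip'.eq_inner]
    exact (TensorProduct.inner_mapIncl_mapIncl _ _ u v).symm
  · intro ip hip _ _
    let ι := (UniformSpace.Completion.toComplₗᵢ (𝕜 := ℂ) (E := H ⊗[ℂ] G)).toLinearMap
    let j : H ⊗[ℂ] G →ₗ[ℂ] ↥(⨆ p, hH.tensorClosure hG p) :=
      ι.codRestrict _ (hH.toCompl_mem_iSup_tensorClosure hG)
    refine ⟨hH.tensor hG, j, ?_, fun x y => ?_, fun lam α => ?_⟩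
    · intro x y hxy
      exact UniformSpace.Completion.toComplₗᵢ.injective (congrArg Subtype.val hxy)
    · rw [hip.eq_inner]
      exact UniformSpace.Completion.inner_coe x y
    · have hclosure : ((hH.tensorSpan hG (lam, α)).map j).topologicalClosure =
          (hH.tensorClosure hG (lam, α)).comap (⨆ p, hH.tensorClosure hG p).subtype := by
        rw [Submodule.topologicalClosure_eq_comap_subtype, ← Submodule.map_comp,
          LinearMap.subtype_comp_codRestrict]
        rfl
      rw [LocallyHilbert.map_tensorSpan] at hclosure
      exact hclosure
end
end

section
/- Let H = ⋃_{λ∈Λ} H_λ and G = ⋃_{α∈A'} G_α be locally Hilbert spaces and let H ⊗_loc G be their locally Hilbert space tensor product over Λ×A'. For T ∈ B_loc(H) and S ∈ B_loc(G), there exists a unique locally bounded operator T ⊗_loc S ∈ B_loc(H ⊗_loc G) such that (T ⊗_loc S)(h ⊗ g) = Th ⊗ Sg for all h ∈ H and g ∈ G. Moreover: (T ⊗_loc S)* = T* ⊗_loc S*; (T ⊗_loc S) ∘ (T' ⊗_loc S') = (T ∘ T') ⊗_loc (S ∘ S'); and if ⟨Th, h⟩ ≥ 0 for all h ∈ H and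 ⟨Sg, g⟩ ≥ 0 for all g ∈ G, then ⟨(T ⊗_loc S)u, u⟩ ≥ 0 for all u ∈ H ⊗_loc G. -/
open scoped InnerProductSpace ComplexOrder

noncomputable section

universe u v w

variable {Λ : Type v} [PartialOrder Λ]
variable {H : Type u} [NormedAddCommGroup H] [InnerProductSpace ℂ H]
variable {K : Type w} [NormedAddCommGroup K] [InnerProductSpace ℂ K]

universe u₁ u₂ u₃ v₁ v₂

/-- `(P, t)` realises the locally Hilbert space tensor product `H ⊗_loc G`: `t` is the
canonical bilinear map, the inner product multiplies on elementary tensors and each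
level `P_{(λ,α)}` is the closure of the span of `t(H_λ × G_α)`. -/
structure IsLocTensor {Λ : Type v₁} [PartialOrder Λ] {A' : Type v₂} [PartialOrder A']
    {H : Type u₁} [NormedAddCommGroup H] [InnerProductSpace ℂ H]
    {G : Type u₂} [NormedAddCommGroup G] [InnerProductSpace ℂ G]
    {P : Type u₃} [NormedAddCommGroup P] [InnerProductSpace ℂ P]
    (hH : LocallyHilbert Λ H) (hG : LocallyHilbert A' G)
    (hP : LocallyHilbert (Λ × A') P) (t : H →ₗ[ℂ] G →ₗ[ℂ] P) : Prop where
  inner_eq : ∀ (h h' : H) (g g' : G), ⟪t h g, t h' g'⟫_ℂ = ⟪h, h'⟫_ℂ * ⟪g, g'⟫_ℂ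
  dense_span : ∀ (lam : Λ) (α : A'),
    (Submodule.span ℂ {u : P | ∃ h ∈ hH.E lam, ∃ g ∈ hG.E α, t h g = u}).topologicalClosure
      = hP.E (lam, α)

/-- `U` acts as `T ⊗ S` on elementary tensors. -/
def IsTensorOp {H G P K N Q : Type*}
    [AddCommGroup H] [Module ℂ H] [AddCommGroup G] [Module ℂ G]
    [AddCommGroup P] [Module ℂ P] [AddCommGroup K] [Module ℂ K]
    [AddCommGroup N] [Module ℂ N] [AddCommGroup Q] [Module ℂ Q]
    (t : H →ₗ[ℂ] G →ₗ[ℂ] P) (t' : K →ₗ[ℂ] N →ₗ[ℂ] Q)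
    (T : H →ₗ[ℂ] K) (S : G →ₗ[ℂ] N) (U : P →ₗ[ℂ] Q) : Prop :=
  ∀ (h : H) (g : G), U (t h g) = t' (T h) (S g)

/-- A linear map that is bounded on a subspace is continuous there. -/
theorem LinearMap.continuous_domRestrict_of_bound (p : Submodule ℂ H) (T : H →ₗ[ℂ] K)
    (hT : ∃ C : ℝ, ∀ h ∈ p, ‖T h‖ ≤ C * ‖h‖) : Continuous (T.domRestrict p) := by
  obtain ⟨C, hC⟩ := hT
  exact ((T.domRestrict p).mkContinuous C fun x ↦ hC x x.2).continuous

theorem IsLAdjoint.symm {T : H →ₗ[ℂ] K} {S : K →ₗ[ℂ] H} (h : IsLAdjoint T S) :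
    IsLAdjoint S T := fun x y ↦ by
  rw [← inner_conj_symm, ← h, inner_conj_symm]

/-- A locally bounded operator has a locally bounded adjoint. -/
theorem IsLocallyBounded.exists_adjoint {hH : LocallyHilbert Λ H} {hK : LocallyHilbert Λ K}
    {T : H →ₗ[ℂ] K} (hT : IsLocallyBounded hH hK T) :
    ∃ S : K →ₗ[ℂ] H, IsLAdjoint T S ∧ IsLocallyBounded hK hH S := by
  have h_ex (k : K) : ∃ v : H, ∀ h, ⟪T h, k⟫_ℂ = ⟪h, v⟫_ℂ := by
    obtain ⟨lam, hk⟩ := hK.exhaustive k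
    obtain ⟨v, -, hv⟩ := hT.adjoint_mem lam k hk
    exact ⟨v, hv⟩
  choose f hf using h_ex
  let S : K →ₗ[ℂ] H :=
    { toFun := f
      map_add' := fun x y ↦ ext_inner_left ℂ fun h ↦ by
        rw [inner_add_right, ← hf, ← hf, ← hf, inner_add_right]
      map_smul' := fun c x ↦ ext_inner_left ℂ fun h ↦ by
        rw [RingHom.id_apply, inner_smul_right, ← hf, ← hf, inner_smul_right] }
  have hS : IsLAdjoint T S := fun h k ↦ hf k h
  have h_mem (lam : Λ) (k : K) (hk : k ∈ hK.E lam) : S k ∈ hH.E lam := by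
    obtain ⟨v, hv, hv'⟩ := hT.adjoint_mem lam k hk
    have : S k = v := ext_inner_left ℂ fun h ↦ by rw [← hS, hv']
    rwa [this]
  refine ⟨S, hS, h_mem, fun lam ↦ ?_, fun lam k hk ↦ ⟨T k, hT.maps_mem lam k hk, fun h ↦ ?_⟩⟩
  · obtain ⟨C, hC⟩ := hT.bound lam
    refine ⟨|C|, fun k hk ↦ ?_⟩
    rcases eq_or_ne (S k) 0 with h0 | h0
    · rw [h0, norm_zero]
      positivity
    · have h1 : ‖S k‖ * ‖S k‖ ≤ |C| * ‖S k‖ * ‖k‖ := by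
        rw [← inner_self_eq_norm_mul_norm (𝕜 := ℂ), ← hS]
        refine (re_inner_le_norm _ _).trans ?_
        gcongr
        exact (hC _ (h_mem lam k hk)).trans (by gcongr; exact le_abs_self C)
      have h2 : 0 < ‖S k‖ := norm_pos_iff.mpr h0
      nlinarith
  · exact hS.symm h k

section TensorOperators

open scoped TensorProduct

theorem LinearMap.isPositive_of_inner_nonneg {E : Type*} [NormedAddCommGroup E]
    [InnerProductSpace ℂ E] {T : E →ₗ[ℂ] E} (hT : ∀ x, 0 ≤ ⟪T x, x⟫_ℂ) : T.IsPositive :=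
  T.isPositive_iff_complex.mpr fun x ↦
    ⟨(Complex.eq_re_of_ofReal_le (hT x)).symm, (Complex.le_def.mp (hT x)).1⟩

theorem LinearMap.IsPositive.posSemidef_inner {E ι : Type*} [NormedAddCommGroup E]
    [InnerProductSpace ℂ E] [Fintype ι] {T : E →ₗ[ℂ] E} (hT : T.IsPositive) (v : ι → E) :
    (Matrix.of fun i j ↦ ⟪v i, T (v j)⟫_ℂ).PosSemidef := by
  refine Matrix.PosSemidef.of_dotProduct_mulVec_nonneg ?_ fun x ↦ ?_
  · ext i j
    simp [Matrix.conjTranspose_apply, hT.isSymmetric (v i) (v j)]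
  · convert hT.inner_nonneg_right (∑ i, x i • v i) using 1
    simp only [map_sum, map_smul, sum_inner, inner_sum, inner_smul_left, inner_smul_right,
      dotProduct, Matrix.mulVec, Matrix.of_apply, Pi.star_apply, Finset.mul_sum, RCLike.star_def]
    rw [Finset.sum_comm]
    refine Finset.sum_congr rfl fun i _ ↦ Finset.sum_congr rfl fun j _ ↦ ?_
    ring

/-- The algebraic tensor product of two positive operators is positive. -/
theorem TensorProduct.inner_map_nonneg {E F : Type*} [NormedAddCommGroup E]
    [InnerProductSpace ℂ E] [NormedAddCommGroup F] [InnerProductSpace ℂ F]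
    {T : E →ₗ[ℂ] E} {S : F →ₗ[ℂ] F} (hT : ∀ x, 0 ≤ ⟪T x, x⟫_ℂ) (hS : ∀ y, 0 ≤ ⟪S y, y⟫_ℂ)
    (x : E ⊗[ℂ] F) : 0 ≤ ⟪TensorProduct.map T S x, x⟫_ℂ := by
  obtain ⟨s, rfl⟩ := TensorProduct.exists_finset x
  have hT' := LinearMap.isPositive_of_inner_nonneg hT
  have hS' := LinearMap.isPositive_of_inner_nonneg hS
  have h := ((hT'.posSemidef_inner fun i : s ↦ i.1.1).hadamard
    (hS'.posSemidef_inner fun i : s ↦ i.1.2)).dotProduct_mulVec_nonneg 1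
  convert h using 1
  rw [← Finset.sum_coe_sort s]
  simp [dotProduct, Matrix.mulVec, map_sum, sum_inner, inner_sum, hT'.isSymmetric _ _,
    hS'.isSymmetric _ _]
  exact Finset.sum_comm

variable {Λ : Type v₁} [PartialOrder Λ] {A' : Type v₂} [PartialOrder A']
  {H : Type u₁} [NormedAddCommGroup H] [InnerProductSpace ℂ H]
  {G : Type u₂} [NormedAddCommGroup G] [InnerProductSpace ℂ G]
  {P : Type u₃} [NormedAddCommGroup P] [InnerProductSpace ℂ P]
  {hH : LocallyHilbert Λ H} {hG : LocallyHilbert A' G}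
  {hP : LocallyHilbert (Λ × A') P} {t : H →ₗ[ℂ] G →ₗ[ℂ] P}

namespace IsLocTensor

theorem inner_lift (ht : IsLocTensor hH hG hP t) (x y : H ⊗[ℂ] G) :
    ⟪TensorProduct.lift t x, TensorProduct.lift t y⟫_ℂ = ⟪x, y⟫_ℂ := by
  induction x with
  | zero => simp
  | add x₁ x₂ h₁ h₂ => rw [map_add, inner_add_left, h₁, h₂, inner_add_left]
  | tmul h g =>
    induction y with
    | zero => simp
    | add y₁ y₂ h₁ h₂ => rw [map_add, inner_add_right, h₁, h₂, inner_add_right]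
    | tmul h' g' => simp [ht.inner_eq]

theorem mem_level (ht : IsLocTensor hH hG hP t) {lam : Λ} {α : A'} {h : H} {g : G}
    (hh : h ∈ hH.E lam) (hg : g ∈ hG.E α) : t h g ∈ hP.E (lam, α) := by
  rw [← ht.dense_span]
  exact Submodule.le_topologicalClosure _ (Submodule.subset_span ⟨h, hh, g, hg, rfl⟩)

theorem lift_mapIncl_mem (ht : IsLocTensor hH hG hP t) (lam : Λ) (α : A')
    (d : hH.E lam ⊗[ℂ] hG.E α) :
    TensorProduct.lift t (TensorProduct.mapIncl (hH.E lam) (hG.E α) d) ∈ hP.E (lam, α) := by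
  induction d with
  | zero => simp
  | add x y hx hy => rw [map_add, map_add]; exact add_mem hx hy
  | tmul h g => exact ht.mem_level h.2 g.2

/-- The canonical map from the algebraic tensor product of two levels into the corresponding
level of the locally Hilbert space tensor product. -/
def levelMap (ht : IsLocTensor hH hG hP t) (lam : Λ) (α : A') :
    hH.E lam ⊗[ℂ] hG.E α →ₗ[ℂ] hP.E (lam, α) :=
  (TensorProduct.lift t ∘ₗ TensorProduct.mapIncl (hH.E lam) (hG.E α)).codRestrict _
    (ht.lift_mapIncl_mem lam α)

theorem coe_levelMap (ht : IsLocTensor hH hG hP t) (lam : Λ) (α : A')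
    (d : hH.E lam ⊗[ℂ] hG.E α) :
    (ht.levelMap lam α d : P) =
      TensorProduct.lift t (TensorProduct.mapIncl (hH.E lam) (hG.E α) d) := rfl

theorem norm_levelMap (ht : IsLocTensor hH hG hP t) (lam : Λ) (α : A')
    (d : hH.E lam ⊗[ℂ] hG.E α) : ‖ht.levelMap lam α d‖ = ‖d‖ := by
  rw [Submodule.coe_norm, coe_levelMap, norm_eq_sqrt_re_inner (𝕜 := ℂ), ht.inner_lift,
    TensorProduct.inner_mapIncl_mapIncl, norm_eq_sqrt_re_inner (𝕜 := ℂ) d]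

theorem denseRange_levelMap (ht : IsLocTensor hH hG hP t) (lam : Λ) (α : A') :
    DenseRange (ht.levelMap lam α) := by
  intro x
  rw [closure_subtype]
  have hx : (x : P) ∈ (Submodule.span ℂ
      {u : P | ∃ h ∈ hH.E lam, ∃ g ∈ hG.E α, t h g = u}).topologicalClosure := by
    rw [ht.dense_span]
    exact x.2
  refine closure_mono ?_ hx
  rw [← Set.range_comp]
  change ((Submodule.span ℂ _ : Submodule ℂ P) : Set P) ⊆
    LinearMap.range (TensorProduct.lift t ∘ₗ TensorProduct.mapIncl (hH.E lam) (hG.E α))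
  refine Submodule.span_le.mpr ?_
  rintro _ ⟨h, hh, g, hg, rfl⟩
  exact ⟨(⟨h, hh⟩ : hH.E lam) ⊗ₜ (⟨g, hg⟩ : hG.E α), by simp⟩

/-- Two additive continuous maps on a level agree if they agree on elementary tensors. -/
theorem level_ext (ht : IsLocTensor hH hG hP t) {lam : Λ} {α : A'}
    {F : Type*} [AddCommGroup F] [TopologicalSpace F] [T2Space F]
    {f₁ f₂ : hP.E (lam, α) →+ F} (h₁ : Continuous f₁) (h₂ : Continuous f₂)
    (h : ∀ (h : hH.E lam) (g : hG.E α),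
      f₁ ⟨t h g, ht.mem_level h.2 g.2⟩ = f₂ ⟨t h g, ht.mem_level h.2 g.2⟩) : f₁ = f₂ := by
  ext x
  refine (ht.denseRange_levelMap lam α).induction_on x (isClosed_eq h₁ h₂) fun d ↦ ?_
  induction d with
  | zero => simp
  | add x y hx hy => rw [map_add, map_add, map_add, hx, hy]
  | tmul a b => exact h a b

/-- Elements are determined by their inner products with elementary tensors. -/
theorem ext_inner_tensor (ht : IsLocTensor hH hG hP t) {x y : P}
    (h : ∀ h g, ⟪x, t h g⟫_ℂ = ⟪y, t h g⟫_ℂ) : x = y := by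
  refine ext_inner_right ℂ fun z ↦ ?_
  obtain ⟨⟨lam, α⟩, hz⟩ := hP.exhaustive z
  have := ht.level_ext (lam := lam) (α := α)
    (f₁ := ((innerSL ℂ x).comp (hP.E (lam, α)).subtypeL).toLinearMap.toAddMonoidHom)
    (f₂ := ((innerSL ℂ y).comp (hP.E (lam, α)).subtypeL).toLinearMap.toAddMonoidHom)
    (ContinuousLinearMap.continuous _) (ContinuousLinearMap.continuous _)
    fun a b ↦ h a b
  exact DFunLike.congr_fun this ⟨z, hz⟩

/-- Two locally bounded operators agreeing on elementary tensors are equal. -/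
theorem op_ext (ht : IsLocTensor hH hG hP t) {U V : P →ₗ[ℂ] P}
    (hU : IsLocallyBounded hP hP U) (hV : IsLocallyBounded hP hP V)
    (h : ∀ h g, U (t h g) = V (t h g)) : U = V := by
  ext x
  obtain ⟨⟨lam, α⟩, hx⟩ := hP.exhaustive x
  have := ht.level_ext (lam := lam) (α := α)
    (f₁ := (U.domRestrict (hP.E (lam, α))).toAddMonoidHom)
    (f₂ := (V.domRestrict (hP.E (lam, α))).toAddMonoidHom)
    (U.continuous_domRestrict_of_bound _ (hU.bound _))
    (V.continuous_domRestrict_of_bound _ (hV.bound _)) fun a b ↦ h a b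
  exact DFunLike.congr_fun this ⟨x, hx⟩

/-- The tensor product of two locally bounded operators, on a single level. -/
theorem exists_level_op (ht : IsLocTensor hH hG hP t) {T : H →ₗ[ℂ] H} {S : G →ₗ[ℂ] G}
    (hT : IsLocallyBounded hH hH T) (hS : IsLocallyBounded hG hG S) (lam : Λ) (α : A') :
    ∃ V : hP.E (lam, α) →L[ℂ] hP.E (lam, α), ∀ (h : hH.E lam) (g : hG.E α),
      (V ⟨t h g, ht.mem_level h.2 g.2⟩ : P) = t (T h) (S g) := by
  obtain ⟨C, hC⟩ := hT.bound lam
  obtain ⟨D, hD⟩ := hS.bound α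
  let T' : hH.E lam →L[ℂ] hH.E lam :=
    (T.restrict (hT.maps_mem lam)).mkContinuous C fun x ↦ hC x x.2
  let S' : hG.E α →L[ℂ] hG.E α :=
    (S.restrict (hS.maps_mem α)).mkContinuous D fun x ↦ hD x x.2
  have : CompleteSpace (hP.E (lam, α)) := (hP.isComplete (lam, α)).completeSpace_coe
  let f := ht.levelMap lam α ∘ₗ (TensorProduct.mapL T' S').toLinearMap
  refine ⟨f.extendOfNorm (ht.levelMap lam α), fun h g ↦ ?_⟩
  have := LinearMap.extendOfNorm_eq (f := f) (ht.denseRange_levelMap lam α)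
    ⟨‖TensorProduct.mapL T' S'‖, fun x ↦ ?_⟩ (h ⊗ₜ g)
  · exact congrArg Subtype.val this
  · rw [ht.norm_levelMap]
    exact (ht.norm_levelMap lam α _).trans_le ((TensorProduct.mapL T' S').le_opNorm x)

/-- The operators on the levels glue to an operator that is bounded on every level. -/
theorem exists_op (ht : IsLocTensor hH hG hP t) {T T' : H →ₗ[ℂ] H} {S S' : G →ₗ[ℂ] G}
    (hT : IsLocallyBounded hH hH T) (hS : IsLocallyBounded hG hG S)
    (hT' : IsLAdjoint T T') (hS' : IsLAdjoint S S') :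
    ∃ U : P →ₗ[ℂ] P, IsTensorOp t t T S U ∧
      (∀ x h g, ⟪U x, t h g⟫_ℂ = ⟪x, t (T' h) (S' g)⟫_ℂ) ∧
      (∀ i, ∀ x ∈ hP.E i, U x ∈ hP.E i) ∧ ∀ i, ∃ C : ℝ, ∀ x ∈ hP.E i, ‖U x‖ ≤ C * ‖x‖ := by
  choose V hV using ht.exists_level_op hT hS
  have h_inner (lam : Λ) (α : A') (x : hP.E (lam, α)) (h : H) (g : G) :
      ⟪(V lam α x : P), t h g⟫_ℂ = ⟪(x : P), t (T' h) (S' g)⟫_ℂ := by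
    rw [← inner_conj_symm, ← inner_conj_symm (x : P)]
    congr 1
    have := ht.level_ext (lam := lam) (α := α)
      (f₁ := ((innerSL ℂ (t h g)).comp
        ((hP.E (lam, α)).subtypeL.comp (V lam α))).toLinearMap.toAddMonoidHom)
      (f₂ := ((innerSL ℂ (t (T' h) (S' g))).comp
        (hP.E (lam, α)).subtypeL).toLinearMap.toAddMonoidHom)
      (ContinuousLinearMap.continuous _) (ContinuousLinearMap.continuous _) fun a b ↦ by
        change ⟪t h g, (V lam α _ : P)⟫_ℂ = ⟪t (T' h) (S' g), t a b⟫_ℂ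
        rw [hV, ← inner_conj_symm, ← inner_conj_symm (t (T' h) (S' g)), ht.inner_eq, ht.inner_eq,
          hT', hS']
    exact DFunLike.congr_fun this x
  choose i hi using hP.exhaustive
  let f : P → P := fun x ↦ V (i x).1 (i x).2 ⟨x, hi x⟩
  have hf (x : P) (h : H) (g : G) : ⟪f x, t h g⟫_ℂ = ⟪x, t (T' h) (S' g)⟫_ℂ := h_inner _ _ _ h g
  let U : P →ₗ[ℂ] P :=
    { toFun := f
      map_add' := fun x y ↦ ht.ext_inner_tensor fun h g ↦ by
        rw [inner_add_left, hf, hf, hf, inner_add_left]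
      map_smul' := fun c x ↦ ht.ext_inner_tensor fun h g ↦ by
        rw [RingHom.id_apply, inner_smul_left, hf, hf, inner_smul_left] }
  have hU (lam : Λ) (α : A') (x : hP.E (lam, α)) : U x = V lam α x :=
    ht.ext_inner_tensor fun h g ↦ (hf x h g).trans (h_inner lam α x h g).symm
  refine ⟨U, fun h g ↦ ?_, hf, ?_, ?_⟩
  · exact ht.ext_inner_tensor fun h' g' ↦ by
      rw [show ⟪U (t h g), t h' g'⟫_ℂ = _ from hf _ _ _, ht.inner_eq, ht.inner_eq, hT', hS']
  · rintro ⟨lam, α⟩ x hx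
    rw [hU lam α ⟨x, hx⟩]
    exact (V lam α _).2
  · rintro ⟨lam, α⟩
    refine ⟨‖V lam α‖, fun x hx ↦ ?_⟩
    rw [hU lam α ⟨x, hx⟩]
    exact (V lam α).le_opNorm ⟨x, hx⟩

/-- The tensor product of two locally bounded operators exists. -/
theorem exists_locallyBounded_op (ht : IsLocTensor hH hG hP t) {T : H →ₗ[ℂ] H} {S : G →ₗ[ℂ] G}
    (hT : IsLocallyBounded hH hH T) (hS : IsLocallyBounded hG hG S) :
    ∃ U : P →ₗ[ℂ] P, IsLocallyBounded hP hP U ∧ IsTensorOp t t T S U := by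
  obtain ⟨T', hTT', hT'⟩ := hT.exists_adjoint
  obtain ⟨S', hSS', hS'⟩ := hS.exists_adjoint
  obtain ⟨U, hU, -, hU_mem, hU_bound⟩ := ht.exists_op hT hS hTT' hSS'
  obtain ⟨V, -, hV, hV_mem, -⟩ := ht.exists_op hT' hS' hTT'.symm hSS'.symm
  refine ⟨U, ⟨hU_mem, hU_bound, fun i k hk ↦ ⟨V k, hV_mem i k hk, fun x ↦ ?_⟩⟩, hU⟩
  obtain ⟨⟨lam, α⟩, hx⟩ := hP.exhaustive x
  rw [← inner_conj_symm, ← inner_conj_symm x]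
  congr 1
  have := ht.level_ext (lam := lam) (α := α)
    (f₁ := ((innerₛₗ ℂ k) ∘ₗ U.domRestrict (hP.E (lam, α))).toAddMonoidHom)
    (f₂ := ((innerSL ℂ (V k)).comp (hP.E (lam, α)).subtypeL).toLinearMap.toAddMonoidHom)
    ((innerSL ℂ k).continuous.comp (U.continuous_domRestrict_of_bound _ (hU_bound _)))
    (ContinuousLinearMap.continuous _) fun a b ↦ by
      change ⟪k, U (t a b)⟫_ℂ = ⟪V k, t a b⟫_ℂ
      rw [hU, hV]
  exact DFunLike.congr_fun this ⟨x, hx⟩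

theorem op_lift {T : H →ₗ[ℂ] H} {S : G →ₗ[ℂ] G} {U : P →ₗ[ℂ] P}
    (hU : IsTensorOp t t T S U) (x : H ⊗[ℂ] G) :
    U (TensorProduct.lift t x) = TensorProduct.lift t (TensorProduct.map T S x) := by
  induction x with
  | zero => simp
  | add x y hx hy => simp only [map_add, hx, hy]
  | tmul h g => simpa using hU h g

/-- The tensor product of two positive operators is positive. -/
theorem op_inner_nonneg (ht : IsLocTensor hH hG hP t) {T : H →ₗ[ℂ] H} {S : G →ₗ[ℂ] G}
    (hT : ∀ h, 0 ≤ ⟪T h, h⟫_ℂ) (hS : ∀ g, 0 ≤ ⟪S g, g⟫_ℂ) {U : P →ₗ[ℂ] P}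
    (hU : IsLocallyBounded hP hP U) (hTS : IsTensorOp t t T S U) (u : P) : 0 ≤ ⟪U u, u⟫_ℂ := by
  obtain ⟨⟨lam, α⟩, hu⟩ := hP.exhaustive u
  refine (ht.denseRange_levelMap lam α).induction_on
    (p := fun x : hP.E (lam, α) ↦ 0 ≤ ⟪U x, x⟫_ℂ) ⟨u, hu⟩ ?_ fun d ↦ ?_
  · exact isClosed_le continuous_const
      ((U.continuous_domRestrict_of_bound _ (hU.bound _)).inner continuous_subtype_val)
  · rw [coe_levelMap, op_lift hTS, ht.inner_lift]
    exact TensorProduct.inner_map_nonneg hT hS _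

end IsLocTensor

end TensorOperators

/-- For `T ∈ B_loc(H)` and `S ∈ B_loc(G)` there is a unique locally
bounded operator `T ⊗_loc S` on `H ⊗_loc G` with `(T ⊗_loc S)(h ⊗ g) = Th ⊗ Sg`;
moreover `(T ⊗_loc S)* = T* ⊗_loc S*`, `(T ⊗_loc S)(T' ⊗_loc S') = (TT') ⊗_loc (SS')`,
and `T ⊗_loc S` is locally positive whenever `T` and `S` are. -/
theorem locallyBounded_tensor_product
    {Λ : Type v₁} [PartialOrder Λ] [Nonempty Λ] [IsDirected Λ (· ≤ ·)]
    {A' : Type v₂} [PartialOrder A'] [Nonempty A'] [IsDirected A' (· ≤ ·)]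
    {H : Type u₁} [NormedAddCommGroup H] [InnerProductSpace ℂ H]
    {G : Type u₂} [NormedAddCommGroup G] [InnerProductSpace ℂ G]
    {P : Type u₃} [NormedAddCommGroup P] [InnerProductSpace ℂ P]
    (hH : LocallyHilbert Λ H) (hG : LocallyHilbert A' G)
    (hP : LocallyHilbert (Λ × A') P) (t : H →ₗ[ℂ] G →ₗ[ℂ] P)
    (ht : IsLocTensor hH hG hP t)
    (T : H →ₗ[ℂ] H) (S : G →ₗ[ℂ] G)
    (hT : IsLocallyBounded hH hH T) (hS : IsLocallyBounded hG hG S) :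
    (∃! U : P →ₗ[ℂ] P, IsLocallyBounded hP hP U ∧ IsTensorOp t t T S U) ∧
    -- `(T ⊗ S)* = T* ⊗ S*`
    (∀ (U : P →ₗ[ℂ] P), IsLocallyBounded hP hP U → IsTensorOp t t T S U →
      ∀ (Tstar : H →ₗ[ℂ] H) (Sstar : G →ₗ[ℂ] G) (Ustar : P →ₗ[ℂ] P),
        IsLAdjoint T Tstar → IsLAdjoint S Sstar → IsLAdjoint U Ustar →
        IsTensorOp t t Tstar Sstar Ustar) ∧
    -- `(T ⊗ S) ∘ (T' ⊗ S') = (T ∘ T') ⊗ (S ∘ S')`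
    (∀ (U : P →ₗ[ℂ] P), IsLocallyBounded hP hP U → IsTensorOp t t T S U →
      ∀ (T' : H →ₗ[ℂ] H) (S' : G →ₗ[ℂ] G) (U' : P →ₗ[ℂ] P),
        IsLocallyBounded hH hH T' → IsLocallyBounded hG hG S' →
        IsLocallyBounded hP hP U' → IsTensorOp t t T' S' U' →
        IsTensorOp t t (T ∘ₗ T') (S ∘ₗ S') (U ∘ₗ U')) ∧
    -- positivity
    ((∀ h : H, 0 ≤ ⟪T h, h⟫_ℂ) → (∀ g : G, 0 ≤ ⟪S g, g⟫_ℂ) →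
      ∀ (U : P →ₗ[ℂ] P), IsLocallyBounded hP hP U → IsTensorOp t t T S U →
        ∀ u : P, 0 ≤ ⟪U u, u⟫_ℂ) := by
  refine ⟨?_, ?_, ?_, fun hT_nonneg hS_nonneg U hU hTS u ↦
    ht.op_inner_nonneg hT_nonneg hS_nonneg hU hTS u⟩
  · obtain ⟨U, hU, hTS⟩ := ht.exists_locallyBounded_op hT hS
    exact ⟨U, ⟨hU, hTS⟩, fun V ⟨hV, hV'⟩ ↦
      ht.op_ext hV hU fun h g ↦ (hV' h g).trans (hTS h g).symm⟩
  · intro U _ hTS T' S' U' hT' hS' hU' h g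
    refine ht.ext_inner_tensor fun h' g' ↦ ?_
    rw [hU'.symm, hTS, ht.inner_eq, ht.inner_eq, hT'.symm, hS'.symm]
  · intro U _ hTS T' S' U' _ _ _ hTS' h g
    simp only [LinearMap.comp_apply, hTS' h g, hTS (T' h) (S' g)]
end
end

section
/- Let k : X × X → B_loc(H) be a positive semidefinite kernel, for a nonempty set X and a locally Hilbert space H = ⋃_{λ∈Λ} H_λ, and let (K; V) be a minimal locally Hilbert space linearisation of k. Define Γ : K → (X → H) by Γ(u)(x) = V(x)* u. Then Γ is linear and injective, ⟨Γ(u)(x), h⟩_H = ⟨u, V(x)h⟩_K for all u ∈ K, x ∈ X, h ∈ H, and Γ(V(y)h) = k(·,y)h for all y ∈ X, h ∈ H. Consequently, R := Γ(K), equipped with the inner product ⟨Γ(u), Γ(u')⟩_R := ⟨u, u'⟩_K, is a reproducing kernel locally Hilbert space with kernel k: k(·,x)h ∈ R and ⟨f, k(·,x)h⟩_R = ⟨f(x), h⟩_H for every f ∈ R, x ∈ X and h ∈ H. -/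
open scoped InnerProductSpace ComplexOrder

noncomputable section

universe u v w

variable {Λ : Type v} [PartialOrder Λ]
variable {H : Type u} [NormedAddCommGroup H] [InnerProductSpace ℂ H]
variable {K : Type w} [NormedAddCommGroup K] [InnerProductSpace ℂ K]

universe u'

/-- A vector in the closed linear span of `s` that is orthogonal to `s` vanishes. -/
theorem eq_zero_of_mem_topologicalClosure_span_of_inner_eq_zero
    {E : Type*} [NormedAddCommGroup E] [InnerProductSpace ℂ E] {s : Set E} {d : E}
    (hd : d ∈ (Submodule.span ℂ s).topologicalClosure) (hs : ∀ v ∈ s, ⟪v, d⟫_ℂ = 0) :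
    d = 0 := by
  have hle : (Submodule.span ℂ s).topologicalClosure ≤ (ℂ ∙ d)ᗮ :=
    Submodule.topologicalClosure_minimal _
      (Submodule.span_le.mpr fun v hv =>
        Submodule.mem_orthogonal_singleton_iff_inner_left.mpr (hs v hv))
      (Submodule.isClosed_orthogonal _)
  exact inner_self_eq_zero.mp (Submodule.mem_orthogonal_singleton_iff_inner_left.mp (hle hd))

/-- From a minimal locally Hilbert space linearisation `(K; V)` of a
positive semidefinite kernel `k`, the map `Γ : K → (X → H)`, `Γ(u)(x) = V(x)* u`,
is linear and injective, satisfies `⟨Γ(u)(x), h⟩ = ⟨u, V(x)h⟩` and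
`Γ(V(y)h) = k(·,y)h`; consequently its range `R`, with the transported inner product
`⟨Γu, Γu'⟩_R := ⟨u, u'⟩_K`, is a reproducing kernel locally Hilbert space with kernel
`k`: each `k(·,x)h` belongs to `R` and `⟨f, k(·,x)h⟩_R = ⟨f(x), h⟩` for `f ∈ R`. -/
theorem minimal_linearisation_reproducing_kernel
    {Λ : Type v} [PartialOrder Λ] [Nonempty Λ] [IsDirected Λ (· ≤ ·)]
    {H : Type u} [NormedAddCommGroup H] [InnerProductSpace ℂ H]
    (hH : LocallyHilbert Λ H)
    {X : Type w} [Nonempty X]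
    (k : X → X → (H →ₗ[ℂ] H))
    (hlb : ∀ x y : X, IsLocallyBounded hH hH (k x y))
    (hpsd : IsPSDKernel (H := H) k)
    {Kc : Type u'} [NormedAddCommGroup Kc] [InnerProductSpace ℂ Kc]
    (hK : LocallyHilbert Λ Kc) (V : X → (H →ₗ[ℂ] Kc))
    (hV : ∀ x : X, IsLocallyBounded hH hK (V x))
    (hVk : ∀ (x y : X) (h g : H), ⟪V x h, V y g⟫_ℂ = ⟪h, k x y g⟫_ℂ)
    (hVmin : ∀ lam : Λ,
      (Submodule.span ℂ {u : Kc | ∃ x : X, ∃ h ∈ hH.E lam, V x h = u}).topologicalClosure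
        = hK.E lam)
    (Vadj : X → (Kc →ₗ[ℂ] H))
    (hVadj : ∀ x : X, IsLAdjoint (V x) (Vadj x))
    (hVadjlb : ∀ x : X, IsLocallyBounded hK hH (Vadj x)) :
    -- Γ(u) := fun x => Vadj x u
    (∀ u u' : Kc, (fun x : X => Vadj x (u + u')) = fun x => Vadj x u + Vadj x u') ∧
    (∀ (c : ℂ) (u : Kc), (fun x : X => Vadj x (c • u)) = fun x => c • Vadj x u) ∧
    Function.Injective (fun (u : Kc) (x : X) => Vadj x u) ∧
    (∀ (u : Kc) (x : X) (h : H), ⟪Vadj x u, h⟫_ℂ = ⟪u, V x h⟫_ℂ) ∧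
    (∀ (y : X) (h : H), (fun x : X => Vadj x (V y h)) = fun x => k x y h) ∧
    -- `k(·,x)h` belongs to `R := range Γ`
    (∀ (x : X) (h : H),
      (fun x' : X => k x' x h) ∈ Set.range (fun (u : Kc) (x' : X) => Vadj x' u)) ∧
    -- reproducing property: `⟨Γ u, k(·,x)h⟩_R = ⟨(Γ u)(x), h⟩_H`, where by definition
    -- `⟨Γ u, Γ (V x h)⟩_R = ⟨u, V x h⟩_K`
    (∀ (u : Kc) (x : X) (h : H), ⟪u, V x h⟫_ℂ = ⟪Vadj x u, h⟫_ℂ) := by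
  have hinner : ∀ (u : Kc) (x : X) (h : H), ⟪Vadj x u, h⟫_ℂ = ⟪u, V x h⟫_ℂ := fun u x h => by
    rw [← inner_conj_symm, ← hVadj x h u, inner_conj_symm]
  have hkernel : ∀ (y : X) (h : H), (fun x : X => Vadj x (V y h)) = fun x => k x y h :=
    fun y h => funext fun x => ext_inner_left ℂ fun g => by rw [← hVadj x g, hVk]
  refine ⟨fun u u' => funext fun x => map_add _ _ _, fun c u => funext fun x => map_smul _ _ _,
    fun u u' huu' => ?_, hinner, hkernel, fun x h => ⟨V x h, hkernel x h⟩,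
    fun u x h => (hinner u x h).symm⟩
  obtain ⟨lam, hlam⟩ := hK.exhaustive (u - u')
  rw [← hVmin lam] at hlam
  refine sub_eq_zero.mp (eq_zero_of_mem_topologicalClosure_span_of_inner_eq_zero hlam ?_)
  rintro _ ⟨x, h, -, rfl⟩
  rw [hVadj x, map_sub, sub_eq_zero.mpr (congrFun huu' x), inner_zero_right]
end
end

section
/- Let X be a nonempty set and H = ⋃_{λ∈Λ} H_λ a locally Hilbert space. Every positive semidefinite kernel k : X × X → B_loc(H) admits a minimal locally Hilbert space linearisation: there exist a locally Hilbert space K = ⋃_{λ∈Λ} K_λ over the same directed poset Λ and a map V : X → B_loc(H,K) such that k(x,y) = V(x)* ∘ V(y) for all x, y ∈ X, and for every λ ∈ Λ the closed linear span of {V(x)h : x ∈ X, h ∈ H_λ} in K_λ equals K_λ. -/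
open scoped InnerProductSpace ComplexOrder

noncomputable section

universe u v w

variable {Λ : Type v} [PartialOrder Λ]
variable {H : Type u} [NormedAddCommGroup H] [InnerProductSpace ℂ H]
variable {K : Type w} [NormedAddCommGroup K] [InnerProductSpace ℂ K]

/-- A complex sesquilinear form that is real and nonnegative on the diagonal is Hermitian. -/
theorem conj_apply_eq_of_apply_self_nonneg {F : Type*} [AddCommGroup F] [Module ℂ F]
    (B : F →ₗ⋆[ℂ] F →ₗ[ℂ] ℂ) (hB : ∀ f, 0 ≤ B f f) (f g : F) :
    starRingEnd ℂ (B g f) = B f g := by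
  have him : ∀ f, (B f f).im = 0 := fun f => (Complex.le_def.1 (hB f)).2.symm
  have h1 := him (f + g)
  have h2 := him (f + Complex.I • g)
  have hf := him f
  have hg := him g
  simp only [map_add, map_smul, map_smulₛₗ, LinearMap.add_apply, LinearMap.smul_apply,
    smul_eq_mul, Complex.conj_I, Complex.add_im, Complex.add_re, Complex.mul_im, Complex.mul_re,
    Complex.neg_re,
    Complex.neg_im, Complex.I_re, Complex.I_im, hf, hg] at h1 h2
  apply Complex.ext
  · simp only [Complex.conj_re]
    linarith
  · simp only [Complex.conj_im]
    linarith

/-- A complex vector space with a positive semidefinite sesquilinear form maps isometrically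
into a Hilbert space. -/
theorem exists_hilbert_of_apply_self_nonneg {F : Type u} [AddCommGroup F] [Module ℂ F]
    (B : F →ₗ⋆[ℂ] F →ₗ[ℂ] ℂ) (hB : ∀ f, 0 ≤ B f f) :
    ∃ (E : Type u) (_ : NormedAddCommGroup E) (_ : InnerProductSpace ℂ E) (_ : CompleteSpace E)
      (ι : F →ₗ[ℂ] E), ∀ f g, ⟪ι f, ι g⟫_ℂ = B f g := by
  let c : PreInnerProductSpace.Core ℂ F :=
    { inner := fun f g => B f g
      conj_inner_symm := fun f g => conj_apply_eq_of_apply_self_nonneg B hB f g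
      re_inner_nonneg := fun f => (Complex.le_def.1 (hB f)).1
      add_left := fun f g h => by simp
      smul_left := fun f g r => by simp }
  let _ : SeminormedAddCommGroup F := @InnerProductSpace.Core.toSeminormedAddCommGroup ℂ F _ _ _ c
  let _ : InnerProductSpace ℂ F := InnerProductSpace.ofCore c
  exact ⟨UniformSpace.Completion F, inferInstance, inferInstance, inferInstance,
    (UniformSpace.Completion.toComplL : F →L[ℂ] UniformSpace.Completion F).toLinearMap,
    fun f g => UniformSpace.Completion.inner_coe f g⟩

/-- The Kolmogorov decomposition of a positive semidefinite kernel, without any boundedness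
assumption on its values. -/
theorem IsPSDKernel.exists_hilbert_linearisation {X : Type w} {k : X → X → (H →ₗ[ℂ] H)}
    (hpsd : IsPSDKernel (H := H) k) :
    ∃ (E : Type (max u w)) (_ : NormedAddCommGroup E) (_ : InnerProductSpace ℂ E)
      (_ : CompleteSpace E) (V : X → (H →ₗ[ℂ] E)),
      ∀ (x y : X) (h g : H), ⟪V x h, V y g⟫_ℂ = ⟪h, k x y g⟫_ℂ := by
  let B : (X →₀ H) →ₗ⋆[ℂ] (X →₀ H) →ₗ[ℂ] ℂ := Finsupp.lsum ℕ fun x =>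
    (innerₛₗ ℂ : H →ₗ⋆[ℂ] H →ₗ[ℂ] ℂ).compl₂ (Finsupp.lsum ℕ fun y => k x y)
  have hBapp : ∀ f g : X →₀ H,
      B f g = ∑ x ∈ f.support, ∑ y ∈ g.support, ⟪f x, k x y (g y)⟫_ℂ := by
    intro f g
    simp [B, Finsupp.sum, LinearMap.sum_apply]
  have hB : ∀ f, 0 ≤ B f f := by
    intro f
    let e := f.support.equivFin
    have h := hpsd f.support.card (fun i => (e.symm i : X)) (fun i => f (e.symm i))
    rw [hBapp]
    convert h using 1
    rw [← Finset.sum_coe_sort, ← e.symm.sum_comp]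
    refine Finset.sum_congr rfl fun i _ => ?_
    rw [← Finset.sum_coe_sort, ← e.symm.sum_comp]
  obtain ⟨E, i₁, i₂, i₃, ι, hι⟩ := exists_hilbert_of_apply_self_nonneg B hB
  refine ⟨E, i₁, i₂, i₃, fun x => ι ∘ₗ Finsupp.lsingle x, fun x y h g => ?_⟩
  simp [hι, B]

section Closure

variable {E : Type*} [NormedAddCommGroup E] [InnerProductSpace ℂ E] {X : Type*}

/-- The closed linear span of the images of `p` under a family of linear maps. -/
def closedSpan (V : X → (H →ₗ[ℂ] E)) (p : Submodule ℂ H) : Submodule ℂ E :=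
  (Submodule.span ℂ {u : E | ∃ x : X, ∃ h ∈ p, V x h = u}).topologicalClosure

theorem mem_closedSpan (V : X → (H →ₗ[ℂ] E)) {p : Submodule ℂ H} (x : X) {h : H} (hh : h ∈ p) :
    V x h ∈ closedSpan V p :=
  Submodule.le_topologicalClosure _ (Submodule.subset_span ⟨x, h, hh, rfl⟩)

theorem closedSpan_mono (V : X → (H →ₗ[ℂ] E)) : Monotone (closedSpan V) := fun _ _ hpq =>
  Submodule.topologicalClosure_mono <| Submodule.span_mono fun _ ⟨x, h, hh, hu⟩ =>
    ⟨x, h, hpq hh, hu⟩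

variable {V : X → (H →ₗ[ℂ] E)} {k : X → X → (H →ₗ[ℂ] H)}

/-- A linearisation is bounded wherever the diagonal of its kernel is. -/
theorem norm_apply_le_of_inner_eq
    (hV : ∀ (x y : X) (h g : H), ⟪V x h, V y g⟫_ℂ = ⟪h, k x y g⟫_ℂ) {x : X} {C : ℝ} {h : H}
    (hC : ‖k x x h‖ ≤ C * ‖h‖) : ‖V x h‖ ≤ √C * ‖h‖ := by
  have hsq : ‖V x h‖ ^ 2 ≤ C * ‖h‖ ^ 2 := by
    rw [← inner_self_eq_norm_sq (𝕜 := ℂ), hV]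
    calc RCLike.re ⟪h, k x x h⟫_ℂ ≤ ‖h‖ * ‖k x x h‖ := re_inner_le_norm _ _
      _ ≤ ‖h‖ * (C * ‖h‖) := by gcongr
      _ = C * ‖h‖ ^ 2 := by ring
  rw [← Real.sqrt_sq (norm_nonneg h), ← Real.sqrt_mul' _ (sq_nonneg _)]
  exact Real.le_sqrt_of_sq_le hsq

/-- If `p` is complete and invariant under the kernel of a linearisation, then elements of the
closed span of `p` are represented, through the linearisation, by elements of `p`. -/
theorem exists_inner_eq_of_mem_closedSpan [CompleteSpace E]
    (hV : ∀ (x y : X) (h g : H), ⟪V x h, V y g⟫_ℂ = ⟪h, k x y g⟫_ℂ) {p : Submodule ℂ H}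
    (hp : IsComplete (p : Set H)) {x : X} (hk : ∀ y, ∀ g ∈ p, k x y g ∈ p)
    (hb : ∃ C : ℝ, ∀ h ∈ p, ‖k x x h‖ ≤ C * ‖h‖) {u : E} (hu : u ∈ closedSpan V p) :
    ∃ v ∈ p, ∀ h : H, ⟪V x h, u⟫_ℂ = ⟪h, v⟫_ℂ := by
  obtain ⟨C, hC⟩ := hb
  have : CompleteSpace p := hp.completeSpace_coe
  let T : p →L[ℂ] E := (V x ∘ₗ p.subtype).mkContinuous (√C) fun h =>
    norm_apply_le_of_inner_eq hV (hC h h.2)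
  refine ⟨(T.adjoint u : p), (T.adjoint u).2, fun h => ?_⟩
  let S : E →ₗ[ℂ] ℂ := innerₛₗ ℂ (V x h) - innerₛₗ ℂ h ∘ₗ p.subtype ∘ₗ T.adjoint.toLinearMap
  have hS : Continuous S := by
    change Continuous fun e => ⟪V x h, e⟫_ℂ - ⟪h, (T.adjoint e : H)⟫_ℂ
    fun_prop
  have hle : closedSpan V p ≤ LinearMap.ker S := by
    refine Submodule.topologicalClosure_minimal _ (Submodule.span_le.2 ?_)
      (isClosed_singleton.preimage hS)
    rintro _ ⟨y, g, hg, rfl⟩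
    have hadj : T.adjoint (V y g) = ⟨k x y g, hk y g hg⟩ := by
      refine ext_inner_left ℂ fun h' => ?_
      rw [ContinuousLinearMap.adjoint_inner_right]
      exact hV x y h' g
    simp [S, hadj, hV]
  simpa [S, sub_eq_zero] using hle hu

end Closure

/-- Every positive semidefinite kernel `k : X × X → B_loc(H)` admits a
minimal locally Hilbert space linearisation `(K; V)`: `k(x,y) = V(x)* ∘ V(y)` and, for
every `λ`, the closed linear span of `{V(x)h : x ∈ X, h ∈ H_λ}` in `K_λ` equals `K_λ`. -/
theorem psdKernel_exists_minimal_linearisation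
    {Λ : Type v} [PartialOrder Λ] [Nonempty Λ] [IsDirected Λ (· ≤ ·)]
    {H : Type u} [NormedAddCommGroup H] [InnerProductSpace ℂ H]
    (hH : LocallyHilbert Λ H)
    {X : Type w} [Nonempty X]
    (k : X → X → (H →ₗ[ℂ] H))
    (hlb : ∀ x y : X, IsLocallyBounded hH hH (k x y))
    (hpsd : IsPSDKernel (H := H) k) :
    ∃ (Kb : LocHilbertBundle.{max u v w, v} Λ) (V : X → (H →ₗ[ℂ] Kb.carrier)),
      (∀ x : X, IsLocallyBounded hH Kb.str (V x)) ∧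
      (∀ (x y : X) (h g : H), ⟪V x h, V y g⟫_ℂ = ⟪h, k x y g⟫_ℂ) ∧
      (∀ lam : Λ,
        (Submodule.span ℂ {u : Kb.carrier | ∃ x : X, ∃ h ∈ hH.E lam, V x h = u}).topologicalClosure
          = Kb.str.E lam) := by
  let k' : ULift.{v} X → ULift.{v} X → (H →ₗ[ℂ] H) := fun x y => k x.down y.down
  have hpsd' : IsPSDKernel (H := H) k' := fun n x h => hpsd n (fun i => (x i).down) h
  obtain ⟨E, _, _, _, V', hV'⟩ := hpsd'.exists_hilbert_linearisation
  let V : X → (H →ₗ[ℂ] E) := fun x => V' ⟨x⟩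
  have hV : ∀ (x y : X) (h g : H), ⟪V x h, V y g⟫_ℂ = ⟪h, k x y g⟫_ℂ :=
    fun x y => hV' ⟨x⟩ ⟨y⟩
  let L : Λ → Submodule ℂ E := fun lam => closedSpan V (hH.E lam)
  have hL : Monotone L := (closedSpan_mono V).comp hH.mono
  let M : Submodule ℂ E := ⨆ lam, L lam
  have hM : ∀ lam, L lam ≤ M := le_iSup L
  let str : LocallyHilbert Λ M :=
    { E := fun lam => (L lam).comap M.subtype
      mono := fun _ _ h => Submodule.comap_mono (hL h)
      isComplete := fun lam => by
        rw [Subtype.isComplete_iff]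
        convert (Submodule.isClosed_topologicalClosure _ : IsClosed (L lam : Set E)).isComplete
        ext u
        exact ⟨fun ⟨w, hw, hwu⟩ => hwu ▸ hw, fun hu => ⟨⟨u, hM lam hu⟩, hu, rfl⟩⟩
      exhaustive := fun u => (Submodule.mem_iSup_of_directed L hL.directed_le).1 u.2 }
  have hVM : ∀ x h, V x h ∈ M := fun x h =>
    let ⟨lam, hlam⟩ := hH.exhaustive h
    hM lam (mem_closedSpan V x hlam)
  refine ⟨⟨M, str⟩, fun x => (V x).codRestrict M (hVM x), fun x => ⟨?_, ?_, ?_⟩,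
    fun x y h g => hV x y h g, fun lam => ?_⟩
  · exact fun lam h hh => mem_closedSpan V x hh
  · intro lam
    obtain ⟨C, hC⟩ := (hlb x x).bound lam
    exact ⟨√C, fun h hh => norm_apply_le_of_inner_eq hV (hC h hh)⟩
  · exact fun lam u hu => exists_inner_eq_of_mem_closedSpan hV (hH.isComplete lam)
      (fun y => (hlb x y).maps_mem lam) ((hlb x x).bound lam) hu
  · apply SetLike.coe_injective
    change closure _ = Subtype.val ⁻¹' closure _
    rw [Topology.IsInducing.subtypeVal.closure_eq_preimage_closure_image]
    have hspan : (Submodule.span ℂ {u : M | ∃ x : X, ∃ h ∈ hH.E lam,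
        (V x).codRestrict M (hVM x) h = u}).map M.subtype =
        Submodule.span ℂ {u : E | ∃ x : X, ∃ h ∈ hH.E lam, V x h = u} := by
      rw [Submodule.map_span]
      congr 1
      ext u
      constructor
      · rintro ⟨_, ⟨x, h, hh, rfl⟩, rfl⟩
        exact ⟨x, h, hh, rfl⟩
      · rintro ⟨x, h, hh, rfl⟩
        exact ⟨_, ⟨x, h, hh, rfl⟩, rfl⟩
    exact congrArg (fun p : Submodule ℂ E => Subtype.val ⁻¹' closure (p : Set E)) hspan
end
end

section
/- Let k : X × X → B_loc(H) be a positive semidefinite kernel, for a nonempty set X and a locally Hilbert space H = ⋃_{λ∈Λ} H_λ. If (K; V) and (K'; V') are two minimal locally Hilbert space linearisations of k, then there exists a locally unitary operator U ∈ B_loc(K, K'), i.e., U* ∘ U = id_K and U ∘ U* = id_{K'}, such that U ∘ V(x) = V'(x) for all x ∈ X. -/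
open scoped InnerProductSpace ComplexOrder

noncomputable section

universe u v w

variable {Λ : Type v} [PartialOrder Λ]
variable {H : Type u} [NormedAddCommGroup H] [InnerProductSpace ℂ H]
variable {K : Type w} [NormedAddCommGroup K] [InnerProductSpace ℂ K]

universe u' u''

/-- A closed subset of a product of two complete sets is complete. -/
theorem isComplete_of_isClosed_of_subset_prod {α β : Type*} [UniformSpace α] [UniformSpace β]
    {s : Set α} {t : Set β} {u : Set (α × β)} (hs : IsComplete s) (ht : IsComplete t)
    (hu : IsClosed u) (hsub : u ⊆ s ×ˢ t) : IsComplete u := by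
  intro f hf hfu
  have hfst : f.map Prod.fst ≤ Filter.principal s :=
    Filter.tendsto_principal.2 (Filter.mem_of_superset (Filter.le_principal_iff.1 hfu)
      fun q hq => (hsub hq).1)
  have hsnd : f.map Prod.snd ≤ Filter.principal t :=
    Filter.tendsto_principal.2 (Filter.mem_of_superset (Filter.le_principal_iff.1 hfu)
      fun q hq => (hsub hq).2)
  obtain ⟨a, -, ha⟩ := hs _ (hf.map uniformContinuous_fst) hfst
  obtain ⟨b, -, hb⟩ := ht _ (hf.map uniformContinuous_snd) hsnd
  have hab : f ≤ nhds (a, b) := Filter.Tendsto.prodMk_nhds (f := f) ha hb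
  have := hf.1
  exact ⟨(a, b), hu.mem_of_tendsto (f := id) hab (Filter.le_principal_iff.1 hfu), hab⟩

/-- The family `V` spans a dense subspace of each member of the locally Hilbert space `hK`,
the vectors being taken from the corresponding member of `hH`. -/
def IsMinimalFamily {X : Type*} (hH : LocallyHilbert Λ H) (hK : LocallyHilbert Λ K)
    (V : X → (H →ₗ[ℂ] K)) : Prop :=
  ∀ lam : Λ,
    (Submodule.span ℂ {u : K | ∃ x : X, ∃ h ∈ hH.E lam, V x h = u}).topologicalClosure
      = hK.E lam

/-- A vector orthogonal to the range of a minimal family vanishes. -/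
theorem IsMinimalFamily.eq_zero {X : Type*} {hH : LocallyHilbert Λ H}
    {hK : LocallyHilbert Λ K} {V : X → (H →ₗ[ℂ] K)} (hmin : IsMinimalFamily hH hK V)
    {c : K} (hc : ∀ x h, ⟪V x h, c⟫_ℂ = 0) : c = 0 := by
  obtain ⟨lam, hlam⟩ := hK.exhaustive c
  have hle : hK.E lam ≤ LinearMap.ker (innerSL ℂ c).toLinearMap := by
    rw [← hmin lam]
    refine Submodule.topologicalClosure_minimal _ (Submodule.span_le.2 ?_)
      (innerSL ℂ c).isClosed_ker
    rintro _ ⟨x, h, -, rfl⟩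
    exact inner_eq_zero_symm.1 (hc x h)
  exact inner_self_eq_zero.1 (show ⟪c, c⟫_ℂ = 0 from hle hlam)

/-- A vector is determined by its inner products with the range of a minimal family. -/
theorem IsMinimalFamily.ext_inner {X : Type*} {hH : LocallyHilbert Λ H}
    {hK : LocallyHilbert Λ K} {V : X → (H →ₗ[ℂ] K)} (hmin : IsMinimalFamily hH hK V)
    {a b : K} (hab : ∀ x h, ⟪V x h, a⟫_ℂ = ⟪V x h, b⟫_ℂ) : a = b :=
  sub_eq_zero.1 (hmin.eq_zero fun x h => by rw [inner_sub_right, hab, sub_self])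

/-- The closed subspace of pairs `q` with `⟪a, q.1⟫ = ⟪b, q.2⟫` contains the closed span of any
set it contains. -/
theorem inner_fst_eq_inner_snd_of_mem_closure_span {K' : Type*} [NormedAddCommGroup K']
    [InnerProductSpace ℂ K'] {s : Set (K × K')} {a : K} {b : K'}
    (hs : ∀ q ∈ s, ⟪a, q.1⟫_ℂ = ⟪b, q.2⟫_ℂ) {q : K × K'}
    (hq : q ∈ (Submodule.span ℂ s).topologicalClosure) : ⟪a, q.1⟫_ℂ = ⟪b, q.2⟫_ℂ := by
  let L : K × K' →L[ℂ] ℂ :=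
    (innerSL ℂ a).comp (ContinuousLinearMap.fst ℂ K K') -
      (innerSL ℂ b).comp (ContinuousLinearMap.snd ℂ K K')
  have hle : (Submodule.span ℂ s).topologicalClosure ≤ LinearMap.ker L.toLinearMap :=
    Submodule.topologicalClosure_minimal _
      (Submodule.span_le.2 fun q hq => sub_eq_zero.2 (hs q hq)) L.isClosed_ker
  exact sub_eq_zero.1 (show ⟪a, q.1⟫_ℂ - ⟪b, q.2⟫_ℂ = 0 from hle hq)

/-- If two families have the same Gram kernel and the first is minimal, every vector of `K_λ` has
a counterpart in `K'_λ` of the same norm and with the same coefficients. -/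
theorem IsMinimalFamily.exists_counterpart {X K' : Type*} [NormedAddCommGroup K']
    [InnerProductSpace ℂ K'] {hH : LocallyHilbert Λ H} {hK : LocallyHilbert Λ K}
    {hK' : LocallyHilbert Λ K'} {V : X → (H →ₗ[ℂ] K)} {V' : X → (H →ₗ[ℂ] K')}
    (hmin : IsMinimalFamily hH hK V)
    (hV : ∀ x, ∀ lam, ∀ h ∈ hH.E lam, V x h ∈ hK.E lam)
    (hV' : ∀ x, ∀ lam, ∀ h ∈ hH.E lam, V' x h ∈ hK'.E lam)
    (hgram : ∀ x y h g, ⟪V x h, V y g⟫_ℂ = ⟪V' x h, V' y g⟫_ℂ)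
    {lam : Λ} {a : K} (ha : a ∈ hK.E lam) :
    ∃ b ∈ hK'.E lam, ‖b‖ = ‖a‖ ∧ ∀ x h, ⟪V' x h, b⟫_ℂ = ⟪V x h, a⟫_ℂ := by
  let s : Set (K × K') := {q | ∃ x : X, ∃ h ∈ hH.E lam, (V x h, V' x h) = q}
  let G : Submodule ℂ (K × K') := (Submodule.span ℂ s).topologicalClosure
  have hcoeff : ∀ q ∈ G, ∀ x h, ⟪V x h, q.1⟫_ℂ = ⟪V' x h, q.2⟫_ℂ := fun q hq x h =>
    inner_fst_eq_inner_snd_of_mem_closure_span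
      (by rintro _ ⟨y, g, -, rfl⟩; exact hgram x y h g) hq
  have hnorm : ∀ q ∈ G, ‖q.2‖ = ‖q.1‖ := fun q hq => by
    have h : ⟪q.1, q.1⟫_ℂ = ⟪q.2, q.2⟫_ℂ := by
      refine inner_fst_eq_inner_snd_of_mem_closure_span (s := s) ?_ hq
      rintro _ ⟨y, g, -, rfl⟩
      rw [← inner_conj_symm, hcoeff q hq, inner_conj_symm]
    rw [norm_eq_sqrt_re_inner (𝕜 := ℂ), norm_eq_sqrt_re_inner (𝕜 := ℂ) q.1, h]
  have hGle : G ≤ (hK.E lam).prod (hK'.E lam) := by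
    refine Submodule.topologicalClosure_minimal _ (Submodule.span_le.2 ?_)
      ((hK.isComplete lam).isClosed.prod (hK'.isComplete lam).isClosed)
    rintro _ ⟨x, h, hh, rfl⟩
    exact ⟨hV x lam h hh, hV' x lam h hh⟩
  have hGcomplete : IsComplete (G : Set (K × K')) :=
    isComplete_of_isClosed_of_subset_prod (hK.isComplete lam) (hK'.isComplete lam)
      (Submodule.isClosed_topologicalClosure _) hGle
  let f : G →ₗᵢ[ℂ] K :=
    { toLinearMap := (LinearMap.fst ℂ K K').comp G.subtype
      norm_map' := fun q => by
        simp [Prod.norm_def, hnorm q q.2] }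
  have : CompleteSpace G := hGcomplete.completeSpace_coe
  have hclosed : IsClosed (LinearMap.range f.toLinearMap : Set K) := by
    rw [LinearMap.coe_range]
    exact f.isometry.isClosedEmbedding.isClosed_range
  have hle : hK.E lam ≤ LinearMap.range f.toLinearMap := by
    rw [← hmin lam]
    refine Submodule.topologicalClosure_minimal _ (Submodule.span_le.2 ?_) hclosed
    rintro _ ⟨x, h, hh, rfl⟩
    exact ⟨⟨(V x h, V' x h), Submodule.le_topologicalClosure _
      (Submodule.subset_span ⟨x, h, hh, rfl⟩)⟩, rfl⟩
  obtain ⟨⟨q, hq⟩, rfl⟩ := hle ha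
  exact ⟨q.2, (hGle hq).2, hnorm q hq, fun x h => (hcoeff q hq x h).symm⟩

/-- Two minimal families with the same Gram kernel are intertwined by a linear isometry that
respects the filtrations. -/
theorem IsMinimalFamily.exists_linearIsometry {X K' : Type*} [NormedAddCommGroup K']
    [InnerProductSpace ℂ K'] {hH : LocallyHilbert Λ H} {hK : LocallyHilbert Λ K}
    {hK' : LocallyHilbert Λ K'} {V : X → (H →ₗ[ℂ] K)} {V' : X → (H →ₗ[ℂ] K')}
    (hmin : IsMinimalFamily hH hK V) (hmin' : IsMinimalFamily hH hK' V')
    (hV : ∀ x, ∀ lam, ∀ h ∈ hH.E lam, V x h ∈ hK.E lam)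
    (hV' : ∀ x, ∀ lam, ∀ h ∈ hH.E lam, V' x h ∈ hK'.E lam)
    (hgram : ∀ x y h g, ⟪V x h, V y g⟫_ℂ = ⟪V' x h, V' y g⟫_ℂ) :
    ∃ U : K →ₗᵢ[ℂ] K', (∀ lam, ∀ a ∈ hK.E lam, U a ∈ hK'.E lam) ∧
      ∀ x h a, ⟪V' x h, U a⟫_ℂ = ⟪V x h, a⟫_ℂ := by
  have hex : ∀ a : K, ∃ b : K', ‖b‖ = ‖a‖ ∧ ∀ x h, ⟪V' x h, b⟫_ℂ = ⟪V x h, a⟫_ℂ := fun a =>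
    have ⟨_, ha⟩ := hK.exhaustive a
    have ⟨b, _, hb⟩ := hmin.exists_counterpart hV hV' hgram ha
    ⟨b, hb⟩
  choose u hnorm hu using hex
  refine ⟨{ toFun := u, map_add' := ?_, map_smul' := ?_, norm_map' := hnorm }, ?_,
    fun x h a => hu a x h⟩
  · exact fun a b => hmin'.ext_inner fun x h => by simp only [inner_add_right, hu]
  · exact fun c a => hmin'.ext_inner fun x h => by simp only [inner_smul_right, hu, RingHom.id_apply]
  · intro lam a ha
    obtain ⟨b, hbmem, -, hb⟩ := hmin.exists_counterpart hV hV' hgram ha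
    have hab : u a = b := hmin'.ext_inner fun x h => by rw [hu, hb]
    exact (congrArg (· ∈ hK'.E lam) hab).mpr hbmem

/-- Mutually inverse filtration-preserving isometries are locally bounded. -/
theorem LinearIsometry.isLocallyBounded_of_rightInverse {K' : Type*} [NormedAddCommGroup K']
    [InnerProductSpace ℂ K'] {hK : LocallyHilbert Λ K} {hK' : LocallyHilbert Λ K'}
    (U : K →ₗᵢ[ℂ] K') (W : K' →ₗᵢ[ℂ] K) (hU : ∀ lam, ∀ a ∈ hK.E lam, U a ∈ hK'.E lam)
    (hW : ∀ lam, ∀ b ∈ hK'.E lam, W b ∈ hK.E lam) (hUW : ∀ b, U (W b) = b) :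
    IsLocallyBounded hK hK' U.toLinearMap where
  maps_mem := hU
  bound _ := ⟨1, fun a _ => by simp⟩
  adjoint_mem lam b hb := ⟨W b, hW lam b hb, fun a => by
    rw [← U.inner_map_map a (W b), hUW, LinearIsometry.coe_toLinearMap]⟩

/-- Two minimal locally Hilbert space linearisations `(K; V)` and
`(K'; V')` of the same positive semidefinite kernel `k` are locally unitarily
equivalent: there is a locally bounded `U : K → K'` with `U* ∘ U = id`, `U ∘ U* = id`
and `U ∘ V(x) = V'(x)` for every `x`. -/
theorem minimal_linearisation_unique
    {Λ : Type v} [PartialOrder Λ] [Nonempty Λ] [IsDirected Λ (· ≤ ·)]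
    {H : Type u} [NormedAddCommGroup H] [InnerProductSpace ℂ H]
    (hH : LocallyHilbert Λ H)
    {X : Type w} [Nonempty X]
    (k : X → X → (H →ₗ[ℂ] H))
    (hlb : ∀ x y : X, IsLocallyBounded hH hH (k x y))
    (hpsd : IsPSDKernel (H := H) k)
    {Kc : Type u'} [NormedAddCommGroup Kc] [InnerProductSpace ℂ Kc]
    (hK : LocallyHilbert Λ Kc) (V : X → (H →ₗ[ℂ] Kc))
    (hV : ∀ x : X, IsLocallyBounded hH hK (V x))
    (hVk : ∀ (x y : X) (h g : H), ⟪V x h, V y g⟫_ℂ = ⟪h, k x y g⟫_ℂ)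
    (hVmin : ∀ lam : Λ,
      (Submodule.span ℂ {u : Kc | ∃ x : X, ∃ h ∈ hH.E lam, V x h = u}).topologicalClosure
        = hK.E lam)
    {Kc' : Type u''} [NormedAddCommGroup Kc'] [InnerProductSpace ℂ Kc']
    (hK' : LocallyHilbert Λ Kc') (V' : X → (H →ₗ[ℂ] Kc'))
    (hV' : ∀ x : X, IsLocallyBounded hH hK' (V' x))
    (hVk' : ∀ (x y : X) (h g : H), ⟪V' x h, V' y g⟫_ℂ = ⟪h, k x y g⟫_ℂ)
    (hVmin' : ∀ lam : Λ,
      (Submodule.span ℂ {u : Kc' | ∃ x : X, ∃ h ∈ hH.E lam, V' x h = u}).topologicalClosure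
        = hK'.E lam) :
    ∃ (U : Kc →ₗ[ℂ] Kc') (Ustar : Kc' →ₗ[ℂ] Kc),
      IsLocallyBounded hK hK' U ∧ IsLocallyBounded hK' hK Ustar ∧
      IsLAdjoint U Ustar ∧
      Ustar ∘ₗ U = LinearMap.id ∧ U ∘ₗ Ustar = LinearMap.id ∧
      ∀ x : X, U ∘ₗ V x = V' x := by
  have hgram : ∀ x y h g, ⟪V x h, V y g⟫_ℂ = ⟪V' x h, V' y g⟫_ℂ := fun x y h g => by
    rw [hVk, hVk']
  have hmin : IsMinimalFamily hH hK V := hVmin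
  have hmin' : IsMinimalFamily hH hK' V' := hVmin'
  have hm := fun x => (hV x).maps_mem
  have hm' := fun x => (hV' x).maps_mem
  obtain ⟨U, hU, hUi⟩ := hmin.exists_linearIsometry hmin' hm hm' hgram
  obtain ⟨W, hW, hWi⟩ := hmin'.exists_linearIsometry hmin hm' hm
    fun x y h g => (hgram x y h g).symm
  have hUW : ∀ b, U (W b) = b := fun b => hmin'.ext_inner fun x h => by rw [hUi, hWi]
  have hWU : ∀ a, W (U a) = a := fun a => hmin.ext_inner fun x h => by rw [hWi, hUi]
  refine ⟨U.toLinearMap, W.toLinearMap, U.isLocallyBounded_of_rightInverse W hU hW hUW,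
    W.isLocallyBounded_of_rightInverse U hW hU hWU, fun a b => ?_, LinearMap.ext hWU,
    LinearMap.ext hUW, fun x => LinearMap.ext fun h => hmin'.ext_inner fun y g => ?_⟩
  · simp only [LinearIsometry.coe_toLinearMap]
    rw [← U.inner_map_map a (W b), hUW]
  · simp only [LinearMap.comp_apply, LinearIsometry.coe_toLinearMap]
    rw [hUi, hgram]
end
end

section
/- Let H = ⋃_{λ∈Λ} H_λ and K = ⋃_{λ∈Λ} K_λ be locally Hilbert spaces over the same directed poset Λ and let T : H → K be a locally bounded operator. Then T is bounded for the canonical norms of H and K (i.e., there exists C ≥ 0 with ‖Th‖ ≤ C‖h‖ for all h ∈ H) if and only if sup_{λ∈Λ} ‖T_λ‖ < ∞. In that case T extends uniquely to a bounded linear operator T̃ between the Hilbert space completions of H and K, and ‖T̃‖ = sup_{λ∈Λ} ‖T_λ‖. -/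
open scoped InnerProductSpace ComplexOrder

noncomputable section

universe u v w

variable {Λ : Type v} [PartialOrder Λ]
variable {H : Type u} [NormedAddCommGroup H] [InnerProductSpace ℂ H]
variable {K : Type w} [NormedAddCommGroup K] [InnerProductSpace ℂ K]

theorem restNorm_nonneg (p : Submodule ℂ H) (T : H →ₗ[ℂ] K) : 0 ≤ restNorm p T :=
  Real.sInf_nonneg fun _ hC => hC.1

theorem restNorm_le_of_bound {p : Submodule ℂ H} {T : H →ₗ[ℂ] K} {C : ℝ} (hC : 0 ≤ C)
    (h : ∀ x ∈ p, ‖T x‖ ≤ C * ‖x‖) : restNorm p T ≤ C :=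
  csInf_le ⟨0, fun _ hC => hC.1⟩ ⟨hC, h⟩

theorem norm_apply_le_restNorm_mul {p : Submodule ℂ H} {T : H →ₗ[ℂ] K}
    (hT : ∃ C : ℝ, ∀ x ∈ p, ‖T x‖ ≤ C * ‖x‖) {x : H} (hx : x ∈ p) :
    ‖T x‖ ≤ restNorm p T * ‖x‖ := by
  obtain ⟨C, hC⟩ := hT
  have hne : {C : ℝ | 0 ≤ C ∧ ∀ h ∈ p, ‖T h‖ ≤ C * ‖h‖}.Nonempty :=
    ⟨max C 0, le_max_right _ _, fun y hy => (hC y hy).trans (by gcongr; exact le_max_left _ _)⟩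
  rcases (norm_nonneg x).eq_or_lt with h0 | h0
  · simpa [← h0] using hC x hx
  · rw [← div_le_iff₀ h0]
    exact le_csInf hne fun D hD => (div_le_iff₀ h0).2 (hD.2 x hx)

theorem IsLocallyBounded.norm_apply_le_iSup_mul {hH : LocallyHilbert Λ H}
    {hK : LocallyHilbert Λ K} {T : H →ₗ[ℂ] K} (hT : IsLocallyBounded hH hK T)
    (hB : BddAbove (Set.range fun lam : Λ => restNorm (hH.E lam) T)) (x : H) :
    ‖T x‖ ≤ (⨆ lam : Λ, restNorm (hH.E lam) T) * ‖x‖ := by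
  obtain ⟨lam, hx⟩ := hH.exhaustive x
  exact (norm_apply_le_restNorm_mul (hT.bound lam) hx).trans
    (mul_le_mul_of_nonneg_right (le_ciSup hB lam) (norm_nonneg x))

open UniformSpace in
/-- A locally bounded operator `T : H → K` is bounded for the
canonical norms iff `sup_λ ‖T_λ‖ < ∞`; in that case it extends uniquely to a bounded
operator `T̃` between the Hilbert space completions, with `‖T̃‖ = sup_λ ‖T_λ‖`. -/
theorem locallyBounded_bounded_iff_sup_lt_top
    {Λ : Type v} [PartialOrder Λ] [Nonempty Λ] [IsDirected Λ (· ≤ ·)]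
    {H : Type u} [NormedAddCommGroup H] [InnerProductSpace ℂ H]
    {K : Type w} [NormedAddCommGroup K] [InnerProductSpace ℂ K]
    (hH : LocallyHilbert Λ H) (hK : LocallyHilbert Λ K)
    (T : H →ₗ[ℂ] K) (hT : IsLocallyBounded hH hK T) :
    ((∃ C : ℝ, 0 ≤ C ∧ ∀ h : H, ‖T h‖ ≤ C * ‖h‖) ↔
      BddAbove (Set.range fun lam : Λ => restNorm (hH.E lam) T)) ∧
    (BddAbove (Set.range fun lam : Λ => restNorm (hH.E lam) T) →
      (∃! Tt : Completion H →L[ℂ] Completion K,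
        ∀ h : H, Tt (↑h : Completion H) = (↑(T h) : Completion K)) ∧
      (∀ Tt : Completion H →L[ℂ] Completion K,
        (∀ h : H, Tt (↑h : Completion H) = (↑(T h) : Completion K)) →
          ‖Tt‖ = ⨆ lam : Λ, restNorm (hH.E lam) T)) := by
  have hnn : 0 ≤ ⨆ lam : Λ, restNorm (hH.E lam) T :=
    Real.iSup_nonneg fun lam => restNorm_nonneg _ T
  refine ⟨⟨?_, fun hB => ⟨_, hnn, hT.norm_apply_le_iSup_mul hB⟩⟩, fun hB => ⟨?_, ?_⟩⟩
  · rintro ⟨C, hC, h⟩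
    refine ⟨C, ?_⟩
    rintro _ ⟨lam, rfl⟩
    exact restNorm_le_of_bound hC fun x _ => h x
  · refine ⟨(T.mkContinuous _ (hT.norm_apply_le_iSup_mul hB)).completion, fun h => by simp,
      fun S hS => ?_⟩
    refine DFunLike.coe_injective (Completion.ext S.continuous
      (ContinuousLinearMap.continuous _) fun h => ?_)
    simp [hS h]
  · intro S hS
    refine le_antisymm (S.opNorm_le_bound hnn fun x => ?_) (ciSup_le fun lam => ?_)
    · induction x using Completion.induction_on with
      | hp => exact isClosed_le (by fun_prop) (by fun_prop)
      | ih h =>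
        rw [hS, Completion.norm_coe, Completion.norm_coe]
        exact hT.norm_apply_le_iSup_mul hB h
    · refine restNorm_le_of_bound (norm_nonneg S) fun x _ => ?_
      simpa only [hS, Completion.norm_coe] using S.le_opNorm (x : Completion H)
end
end

section
/- Let H = ⋃_{λ∈Λ} H_λ and K = ⋃_{λ∈Λ} K_λ be locally Hilbert spaces over the same directed poset Λ. Then B_loc(H,K) is complete with respect to the family of seminorms q_λ: for every net (T_j)_{j∈J} in B_loc(H,K) which is Cauchy with respect to each q_λ (i.e., for every λ ∈ Λ and ε > 0 there is j₀ ∈ J with q_λ(T_j − T_{j'}) < ε for all j, j' ≥ j₀), there exists T ∈ B_loc(H,K) such that q_λ(T_j − T) → 0 for every λ ∈ Λ. -/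
open scoped InnerProductSpace ComplexOrder

noncomputable section

universe u v w

variable {Λ : Type v} [PartialOrder Λ]
variable {H : Type u} [NormedAddCommGroup H] [InnerProductSpace ℂ H]
variable {K : Type w} [NormedAddCommGroup K] [InnerProductSpace ℂ K]

universe x

/-- A net in a complete set that is Cauchy, with moduli scaled by a fixed constant `M`,
converges in that set. -/
theorem exists_tendsto_of_isComplete {J : Type*} [Preorder J] [Nonempty J]
    [IsDirected J (· ≤ ·)] {E : Type*} [NormedAddCommGroup E] {s : Set E} (hs : IsComplete s)
    {f : J → E} (hf : ∀ j, f j ∈ s) (M : ℝ)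
    (hM : ∀ ε : ℝ, 0 < ε → ∃ j₀ : J, ∀ j j' : J, j₀ ≤ j → j₀ ≤ j' → ‖f j - f j'‖ ≤ ε * M) :
    ∃ a ∈ s, Filter.Tendsto f Filter.atTop (nhds a) := by
  refine hs (Filter.map f Filter.atTop) ?_ ?_
  · refine Metric.cauchy_iff.2 ⟨inferInstance, fun ε hε => ?_⟩
    obtain ⟨j₀, hj₀⟩ := hM (ε / (|M| + 1)) (by positivity)
    refine ⟨f '' Set.Ici j₀, Filter.image_mem_map (Filter.Ici_mem_atTop j₀), ?_⟩
    rintro _ ⟨j, hj, rfl⟩ _ ⟨j', hj', rfl⟩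
    rw [dist_eq_norm]
    refine (hj₀ j j' hj hj').trans_lt ?_
    rw [div_mul_eq_mul_div, div_lt_iff₀ (by positivity)]
    exact mul_lt_mul_of_pos_left (by linarith [le_abs_self M]) hε
  · exact Filter.le_principal_iff.2 (Filter.mem_map.2 (Filter.Eventually.of_forall hf))

/-- If `T` is bounded on `p` and the norm of its restriction is less than `ε`, then `ε` is a
bound for `T` on `p`. -/
theorem norm_le_of_restNorm_lt {p : Submodule ℂ H} {T : H →ₗ[ℂ] K}
    (hT : ∃ C : ℝ, ∀ h ∈ p, ‖T h‖ ≤ C * ‖h‖) {ε : ℝ} (hε : restNorm p T < ε)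
    {h : H} (hh : h ∈ p) : ‖T h‖ ≤ ε * ‖h‖ := by
  obtain ⟨C, hC⟩ := hT
  obtain ⟨D, ⟨-, hD⟩, hDε⟩ := exists_lt_of_csInf_lt (by
    exact ⟨|C|, abs_nonneg C, fun h hh => (hC h hh).trans
      (mul_le_mul_of_nonneg_right (le_abs_self C) (norm_nonneg h))⟩) hε
  exact (hD h hh).trans (mul_le_mul_of_nonneg_right hDε.le (norm_nonneg h))

theorem restNorm_le {p : Submodule ℂ H} {T : H →ₗ[ℂ] K} {C : ℝ} (hC : 0 ≤ C)
    (hT : ∀ h ∈ p, ‖T h‖ ≤ C * ‖h‖) : restNorm p T ≤ C :=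
  csInf_le ⟨0, fun _ hD => hD.1⟩ ⟨hC, hT⟩

/-- The difference of two operators bounded on a submodule is bounded on it. -/
theorem exists_bound_sub {p : Submodule ℂ H} {S T : H →ₗ[ℂ] K}
    (hS : ∃ C : ℝ, ∀ h ∈ p, ‖S h‖ ≤ C * ‖h‖) (hT : ∃ C : ℝ, ∀ h ∈ p, ‖T h‖ ≤ C * ‖h‖) :
    ∃ C : ℝ, ∀ h ∈ p, ‖(S - T) h‖ ≤ C * ‖h‖ := by
  obtain ⟨C, hC⟩ := hS
  obtain ⟨D, hD⟩ := hT
  refine ⟨C + D, fun h hh => ?_⟩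
  rw [LinearMap.sub_apply, add_mul]
  exact (norm_sub_le _ _).trans (add_le_add (hC h hh) (hD h hh))

/-- If `v` and `w` in `p` represent the functionals `⟪S ·, k⟫` and `⟪T ·, k⟫`, then a bound for
`S - T` on `p` controls their distance. -/
theorem norm_sub_le_of_represent {p : Submodule ℂ H} {S T : H →ₗ[ℂ] K} {ε : ℝ}
    (hST : ∀ h ∈ p, ‖(S - T) h‖ ≤ ε * ‖h‖) (hε : 0 ≤ ε) {k : K} {v w : H}
    (hv : v ∈ p) (hw : w ∈ p) (hSv : ∀ h, ⟪S h, k⟫_ℂ = ⟪h, v⟫_ℂ)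
    (hTw : ∀ h, ⟪T h, k⟫_ℂ = ⟪h, w⟫_ℂ) : ‖v - w‖ ≤ ε * ‖k‖ := by
  have key : ‖v - w‖ * ‖v - w‖ ≤ ε * ‖k‖ * ‖v - w‖ := by
    have hinner : ⟪v - w, v - w⟫_ℂ = ⟪(S - T) (v - w), k⟫_ℂ := by
      rw [LinearMap.sub_apply, inner_sub_left (S (v - w)), hSv, hTw, ← inner_sub_right]
    calc ‖v - w‖ * ‖v - w‖ = ‖⟪v - w, v - w⟫_ℂ‖ := by
          rw [inner_self_eq_norm_sq_to_K]; simp [sq]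
      _ ≤ ‖(S - T) (v - w)‖ * ‖k‖ := hinner ▸ norm_inner_le_norm _ _
      _ ≤ ε * ‖v - w‖ * ‖k‖ :=
          mul_le_mul_of_nonneg_right (hST _ (p.sub_mem hv hw)) (norm_nonneg k)
      _ = ε * ‖k‖ * ‖v - w‖ := by ring
  rcases (norm_nonneg (v - w)).eq_or_lt with h0 | hpos
  · rw [← h0]; positivity
  · exact le_of_mul_le_mul_right key hpos

/-- `B_loc(H,K)` is complete with respect to the family of seminorms
`q_λ(T) = ‖T_λ‖`: every net of locally bounded operators which is Cauchy for each `q_λ`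
converges, for each `q_λ`, to a locally bounded operator. -/
theorem locallyBounded_complete_seminorms
    {Λ : Type v} [PartialOrder Λ] [Nonempty Λ] [IsDirected Λ (· ≤ ·)]
    {H : Type u} [NormedAddCommGroup H] [InnerProductSpace ℂ H]
    {K : Type w} [NormedAddCommGroup K] [InnerProductSpace ℂ K]
    (hH : LocallyHilbert Λ H) (hK : LocallyHilbert Λ K)
    {J : Type x} [Preorder J] [Nonempty J] [IsDirected J (· ≤ ·)]
    (Tn : J → (H →ₗ[ℂ] K))
    (hTn : ∀ j : J, IsLocallyBounded hH hK (Tn j))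
    (hCauchy : ∀ (lam : Λ) (ε : ℝ), 0 < ε → ∃ j₀ : J, ∀ j j' : J, j₀ ≤ j → j₀ ≤ j' →
      restNorm (hH.E lam) (Tn j - Tn j') < ε) :
    ∃ T : H →ₗ[ℂ] K, IsLocallyBounded hH hK T ∧
      ∀ (lam : Λ) (ε : ℝ), 0 < ε → ∃ j₀ : J, ∀ j : J, j₀ ≤ j →
        restNorm (hH.E lam) (Tn j - T) < ε := by
  have hsub : ∀ (lam : Λ) (ε : ℝ), 0 < ε → ∃ j₀ : J, ∀ j j' : J, j₀ ≤ j → j₀ ≤ j' →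
      ∀ h ∈ hH.E lam, ‖(Tn j - Tn j') h‖ ≤ ε * ‖h‖ := by
    intro lam ε hε
    obtain ⟨j₀, hj₀⟩ := hCauchy lam ε hε
    exact ⟨j₀, fun j j' hj hj' h hh => norm_le_of_restNorm_lt
      (exists_bound_sub ((hTn j).bound lam) ((hTn j').bound lam)) (hj₀ j j' hj hj') hh⟩
  have hlim : ∀ (lam : Λ), ∀ h ∈ hH.E lam, ∃ y ∈ hK.E lam,
      Filter.Tendsto (fun j => Tn j h) Filter.atTop (nhds y) := by
    intro lam h hh
    refine exists_tendsto_of_isComplete (hK.isComplete lam)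
      (fun j => (hTn j).maps_mem lam h hh) ‖h‖ fun ε hε => ?_
    obtain ⟨j₀, hj₀⟩ := hsub lam ε hε
    exact ⟨j₀, fun j j' hj hj' => hj₀ j j' hj hj' h hh⟩
  have hex : ∀ h : H, ∃ y : K, Filter.Tendsto (fun j => Tn j h) Filter.atTop (nhds y) := by
    intro h
    obtain ⟨lam, hh⟩ := hH.exhaustive h
    obtain ⟨y, -, hy⟩ := hlim lam h hh
    exact ⟨y, hy⟩
  choose t ht using hex
  let T : H →ₗ[ℂ] K :=
    { toFun := t
      map_add' := fun a b => tendsto_nhds_unique (ht (a + b))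
        (by simpa only [map_add] using (ht a).add (ht b))
      map_smul' := fun c a => tendsto_nhds_unique (ht (c • a))
        (by simpa only [map_smul, RingHom.id_apply] using (ht a).const_smul c) }
  have hT : ∀ h, Filter.Tendsto (fun j => Tn j h) Filter.atTop (nhds (T h)) := ht
  have happrox : ∀ (lam : Λ) (ε : ℝ), 0 < ε → ∃ j₀ : J, ∀ j : J, j₀ ≤ j →
      ∀ h ∈ hH.E lam, ‖(Tn j - T) h‖ ≤ ε * ‖h‖ := by
    intro lam ε hε
    obtain ⟨j₀, hj₀⟩ := hsub lam ε hε
    refine ⟨j₀, fun j hj h hh => ?_⟩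
    refine le_of_tendsto ((tendsto_const_nhds (x := Tn j h)).sub (hT h)).norm ?_
    filter_upwards [Filter.Ici_mem_atTop j₀] with j' hj'
    exact hj₀ j j' hj hj' h hh
  refine ⟨T, ⟨fun lam h hh => ?_, fun lam => ?_, fun lam k hk => ?_⟩, fun lam ε hε => ?_⟩
  · obtain ⟨y, hy, hTy⟩ := hlim lam h hh
    rwa [tendsto_nhds_unique (hT h) hTy]
  · obtain ⟨j₀, hj₀⟩ := happrox lam 1 one_pos
    obtain ⟨C, hC⟩ := exists_bound_sub ((hTn j₀).bound lam) ⟨1, hj₀ j₀ le_rfl⟩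
    exact ⟨C, fun h hh => by simpa using hC h hh⟩
  · choose v hv hTv using fun j => (hTn j).adjoint_mem lam k hk
    obtain ⟨w, hw, hvw⟩ := exists_tendsto_of_isComplete (hH.isComplete lam) hv ‖k‖
      fun ε hε => by
        obtain ⟨j₀, hj₀⟩ := hsub lam ε hε
        exact ⟨j₀, fun j j' hj hj' => norm_sub_le_of_represent (hj₀ j j' hj hj') hε.le
          (hv j) (hv j') (hTv j) (hTv j')⟩
    refine ⟨w, hw, fun h => tendsto_nhds_unique ((hT h).inner tendsto_const_nhds) ?_⟩
    simpa only [hTv] using (tendsto_const_nhds (x := h)).inner hvw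
  · obtain ⟨j₀, hj₀⟩ := happrox lam (ε / 2) (half_pos hε)
    exact ⟨j₀, fun j hj => (restNorm_le (half_pos hε).le (hj₀ j hj)).trans_lt (half_lt_self hε)⟩
end
end

section
/- Let H = ⋃_{λ∈Λ} H_λ be a locally Hilbert space and T ∈ B_loc(H). The following are equivalent: (i) ⟨T h, h⟩ is a nonnegative real number for every h ∈ H (T is locally positive); (ii) there exists S ∈ B_loc(H) such that T = S* ∘ S. -/
open scoped InnerProductSpace ComplexOrder

noncomputable section

universe u v w

variable {Λ : Type v} [PartialOrder Λ]
variable {H : Type u} [NormedAddCommGroup H] [InnerProductSpace ℂ H]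
variable {K : Type w} [NormedAddCommGroup K] [InnerProductSpace ℂ K]

/-- The square root of an operator on a complex Hilbert space, given by the continuous
functional calculus. -/
def ContinuousLinearMap.hilbertSqrt {V : Type*} [NormedAddCommGroup V] [InnerProductSpace ℂ V]
    [CompleteSpace V] (A : V →L[ℂ] V) : V →L[ℂ] V :=
  CFC.sqrt A

theorem ContinuousLinearMap.inner_hilbertSqrt_left {V : Type*} [NormedAddCommGroup V]
    [InnerProductSpace ℂ V] [CompleteSpace V] (A : V →L[ℂ] V) (x y : V) :
    ⟪A.hilbertSqrt x, y⟫_ℂ = ⟪x, A.hilbertSqrt y⟫_ℂ :=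
  ((nonneg_iff_isPositive _).1 (CFC.sqrt_nonneg A)).isSymmetric x y

theorem ContinuousLinearMap.hilbertSqrt_hilbertSqrt_apply {V : Type*} [NormedAddCommGroup V]
    [InnerProductSpace ℂ V] [CompleteSpace V] {A : V →L[ℂ] V} (hA : 0 ≤ A) (x : V) :
    A.hilbertSqrt (A.hilbertSqrt x) = A x :=
  DFunLike.congr_fun (CFC.sqrt_mul_sqrt_self A hA) x

open ContinuousLinearMap in
/-- An isometry intertwining two positive operators intertwines their square roots. -/
theorem LinearIsometry.hilbertSqrt_apply_of_intertwines
    {V : Type*} [NormedAddCommGroup V] [InnerProductSpace ℂ V] [CompleteSpace V]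
    {W : Type*} [NormedAddCommGroup W] [InnerProductSpace ℂ W] [CompleteSpace W]
    (i : V →ₗᵢ[ℂ] W) {A : W →L[ℂ] W} {B : V →L[ℂ] V} (hA : 0 ≤ A) (hB : 0 ≤ B)
    (h : ∀ x, A (i x) = i (B x)) (x : V) :
    A.hilbertSqrt (i x) = i (B.hilbertSqrt x) := by
  simp only [hilbertSqrt]
  set J : V →L[ℂ] W := i.toContinuousLinearMap
  have hJJ : adjoint J ∘L J = 1 := i.adjoint_comp_self
  have hAJ : A ∘L J = J ∘L B := ContinuousLinearMap.ext h
  have hJA : adjoint J ∘L A = B ∘L adjoint J := by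
    have := congrArg adjoint hAJ
    rwa [adjoint_comp, adjoint_comp, hA.isSelfAdjoint.adjoint_eq,
      hB.isSelfAdjoint.adjoint_eq] at this
  have hcomm : Commute A (J ∘L adjoint J) := by
    change A ∘L (J ∘L adjoint J) = (J ∘L adjoint J) ∘L A
    rw [← ContinuousLinearMap.comp_assoc, hAJ, ContinuousLinearMap.comp_assoc,
      ContinuousLinearMap.comp_assoc, hJA]
  have hRP : CFC.sqrt A ∘L (J ∘L adjoint J) = (J ∘L adjoint J) ∘L CFC.sqrt A :=
    hcomm.cfcₙ_nnreal NNReal.sqrt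
  have hRJ : CFC.sqrt A ∘L J = J ∘L (adjoint J ∘L CFC.sqrt A ∘L J) := by
    calc CFC.sqrt A ∘L J = (CFC.sqrt A ∘L (J ∘L adjoint J)) ∘L J := by
          rw [ContinuousLinearMap.comp_assoc, ContinuousLinearMap.comp_assoc, hJJ]; rfl
      _ = J ∘L (adjoint J ∘L CFC.sqrt A ∘L J) := by rw [hRP]; rfl
  have hpos : 0 ≤ adjoint J ∘L CFC.sqrt A ∘L J := by
    rw [nonneg_iff_isPositive]
    exact ((nonneg_iff_isPositive _).1 (CFC.sqrt_nonneg A)).adjoint_conj J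
  have hsq : (adjoint J ∘L CFC.sqrt A ∘L J) * (adjoint J ∘L CFC.sqrt A ∘L J) = B := by
    calc _ = adjoint J ∘L CFC.sqrt A ∘L (J ∘L (adjoint J ∘L CFC.sqrt A ∘L J)) := rfl
      _ = adjoint J ∘L (CFC.sqrt A * CFC.sqrt A) ∘L J := by rw [← hRJ]; rfl
      _ = (adjoint J ∘L J) ∘L B := by rw [CFC.sqrt_mul_sqrt_self A hA, hAJ]; rfl
      _ = B := by rw [hJJ]; rfl
  rw [CFC.sqrt_unique hsq hpos]
  exact DFunLike.congr_fun hRJ x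

/-- A compatible family of linear maps on the members of a locally Hilbert space glues to a
linear map on the whole space. -/
theorem LocallyHilbert.exists_linearMap_of_compatible
    {Λ : Type*} [PartialOrder Λ] [IsDirected Λ (· ≤ ·)]
    {H : Type*} [NormedAddCommGroup H] [InnerProductSpace ℂ H] (hH : LocallyHilbert Λ H)
    {M : Type*} [AddCommGroup M] [Module ℂ M] (R : ∀ lam, hH.E lam →ₗ[ℂ] M)
    (hR : ∀ lam mu (hle : lam ≤ mu) (x : hH.E lam),
      R mu ⟨x, hH.mono hle x.2⟩ = R lam x) :
    ∃ S : H →ₗ[ℂ] M, ∀ lam (x : hH.E lam), S x = R lam x := by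
  choose c hc using hH.exhaustive
  have key : ∀ lam (x : hH.E lam), R (c x) ⟨x, hc x⟩ = R lam x := by
    intro lam x
    obtain ⟨mu, h₁, h₂⟩ := exists_ge_ge (c (x : H)) lam
    rw [← hR _ mu h₁, ← hR _ mu h₂]
  refine ⟨{ toFun := fun x => R (c x) ⟨x, hc x⟩, map_add' := ?_, map_smul' := ?_ }, key⟩
  · intro x y
    obtain ⟨mu, h₁, h₂⟩ := exists_ge_ge (c x) (c y)
    have hx : x ∈ hH.E mu := hH.mono h₁ (hc x)
    have hy : y ∈ hH.E mu := hH.mono h₂ (hc y)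
    rw [key mu ⟨x, hx⟩, key mu ⟨y, hy⟩, ← map_add]
    exact key mu (⟨x, hx⟩ + ⟨y, hy⟩)
  · intro a x
    rw [RingHom.id_apply, ← map_smul]
    exact key (c x) (a • ⟨x, hc x⟩)

/-- A locally bounded operator `T` on a locally Hilbert space is
locally positive (`⟨T h, h⟩ ≥ 0` for all `h`) if and only if `T = S* ∘ S` for some
locally bounded `S` (expressed by `⟪T h, k⟫ = ⟪S h, S k⟫` for all `h, k`). -/
theorem locallyBounded_positive_iff_star_mul_self
    {Λ : Type v} [PartialOrder Λ] [Nonempty Λ] [IsDirected Λ (· ≤ ·)]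
    {H : Type u} [NormedAddCommGroup H] [InnerProductSpace ℂ H]
    (hH : LocallyHilbert Λ H)
    (T : H →ₗ[ℂ] H) (hT : IsLocallyBounded hH hH T) :
    (∀ h : H, 0 ≤ ⟪T h, h⟫_ℂ) ↔
      (∃ S : H →ₗ[ℂ] H, IsLocallyBounded hH hH S ∧
        ∀ h k : H, ⟪T h, k⟫_ℂ = ⟪S h, S k⟫_ℂ) := by
  constructor
  · intro hpos
    have hcomplete (lam : Λ) : CompleteSpace (hH.E lam) := (hH.isComplete lam).completeSpace_coe
    choose C hC using hT.bound
    let A (lam : Λ) : hH.E lam →L[ℂ] hH.E lam :=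
      (T.restrict (hT.maps_mem lam)).mkContinuous (C lam) fun x => hC lam x x.2
    have hA (lam : Λ) : 0 ≤ A lam := by
      rw [ContinuousLinearMap.nonneg_iff_isPositive, ContinuousLinearMap.isPositive_iff_complex]
      intro x
      have hx : 0 ≤ ⟪A lam x, x⟫_ℂ := hpos x
      rw [Complex.nonneg_iff] at hx
      exact ⟨Complex.ext rfl hx.2, hx.1⟩
    obtain ⟨S, hS⟩ := hH.exists_linearMap_of_compatible
      (fun lam => (hH.E lam).subtype ∘ₗ (A lam).hilbertSqrt.toLinearMap) (by
        intro lam mu hle x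
        let i : hH.E lam →ₗᵢ[ℂ] hH.E mu :=
          ⟨Submodule.inclusion (hH.mono hle), fun _ => rfl⟩
        exact congrArg Subtype.val
          (i.hilbertSqrt_apply_of_intertwines (hA mu) (hA lam) (fun _ => rfl) x))
    have hSmem (lam : Λ) (h : H) (hh : h ∈ hH.E lam) : S h ∈ hH.E lam := by
      rw [hS lam ⟨h, hh⟩]
      exact ((A lam).hilbertSqrt ⟨h, hh⟩).2
    have hsymm (h k : H) : ⟪S h, k⟫_ℂ = ⟪h, S k⟫_ℂ := by
      obtain ⟨a, ha⟩ := hH.exhaustive h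
      obtain ⟨b, hb⟩ := hH.exhaustive k
      obtain ⟨mu, h₁, h₂⟩ := exists_ge_ge a b
      rw [hS mu ⟨h, hH.mono h₁ ha⟩, hS mu ⟨k, hH.mono h₂ hb⟩]
      exact (A mu).inner_hilbertSqrt_left ⟨h, hH.mono h₁ ha⟩ ⟨k, hH.mono h₂ hb⟩
    have hSS (h : H) : S (S h) = T h := by
      obtain ⟨mu, hh⟩ := hH.exhaustive h
      rw [hS mu ⟨h, hh⟩]
      refine (hS mu ((A mu).hilbertSqrt ⟨h, hh⟩)).trans ?_
      exact congrArg Subtype.val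
        (ContinuousLinearMap.hilbertSqrt_hilbertSqrt_apply (hA mu) ⟨h, hh⟩)
    refine ⟨S, ⟨hSmem, fun lam => ⟨‖(A lam).hilbertSqrt‖, fun h hh => ?_⟩,
      fun lam k hk => ⟨S k, hSmem lam k hk, fun h => hsymm h k⟩⟩, fun h k => ?_⟩
    · rw [hS lam ⟨h, hh⟩]
      exact (A lam).hilbertSqrt.le_opNorm ⟨h, hh⟩
    · rw [← hSS, hsymm]
  · rintro ⟨S, -, hS⟩ h
    rw [hS, Complex.nonneg_iff]
    exact ⟨inner_self_nonneg (𝕜 := ℂ), (inner_self_im (𝕜 := ℂ) (S h)).symm⟩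
end
end

section
/- Let H = ⋃_{λ∈Λ} H_λ and K = ⋃_{λ∈Λ} K_λ be locally Hilbert spaces over the same directed poset Λ. Let (T_j)_{j∈J} be a net in B_loc(H,K) such that for every λ ∈ Λ: for each h ∈ H_λ the net (T_j h)_j is Cauchy in the Hilbert space K_λ, and for each k ∈ K_λ the net (T_j* k)_j is Cauchy in the Hilbert space H_λ. Then there exists T ∈ B_loc(H,K) such that T_j h → T h in K_λ for every λ ∈ Λ and h ∈ H_λ, and T_j* k → T* k in H_λ for every λ ∈ Λ and k ∈ K_λ; that is, B_loc(H,K) is complete with respect to the strict topology. -/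
open scoped InnerProductSpace ComplexOrder

noncomputable section

universe u v w

variable {Λ : Type v} [PartialOrder Λ]
variable {H : Type u} [NormedAddCommGroup H] [InnerProductSpace ℂ H]
variable {K : Type w} [NormedAddCommGroup K] [InnerProductSpace ℂ K]

universe x

open Filter Topology

/-- A net of linear maps preserving the filtrations which is pointwise Cauchy converges pointwise
to a linear map preserving the filtrations. -/
theorem LocallyHilbert.exists_linearMap_tendsto (hH : LocallyHilbert Λ H)
    (hK : LocallyHilbert Λ K) {J : Type x} [Preorder J] [Nonempty J] [IsDirected J (· ≤ ·)]
    (S : J → (H →ₗ[ℂ] K)) (hS : ∀ j lam, ∀ h ∈ hH.E lam, S j h ∈ hK.E lam)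
    (hCauchy : ∀ lam : Λ, ∀ h ∈ hH.E lam, ∀ ε : ℝ, 0 < ε →
      ∃ j₀ : J, ∀ j j' : J, j₀ ≤ j → j₀ ≤ j' → ‖S j h - S j' h‖ < ε) :
    ∃ T : H →ₗ[ℂ] K, (∀ lam, ∀ h ∈ hH.E lam, T h ∈ hK.E lam) ∧
      ∀ h, Tendsto (fun j => S j h) atTop (𝓝 (T h)) := by
  have key : ∀ lam, ∀ h ∈ hH.E lam,
      ∃ y ∈ hK.E lam, Tendsto (fun j => S j h) atTop (𝓝 y) := by
    intro lam h hh
    have hc : Cauchy (map (fun j => S j h) atTop) := by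
      refine Metric.cauchy_iff.2 ⟨inferInstance, fun ε hε => ?_⟩
      obtain ⟨j₀, hj₀⟩ := hCauchy lam h hh ε hε
      refine ⟨_, image_mem_map (Ici_mem_atTop j₀), ?_⟩
      rintro _ ⟨j, hj, rfl⟩ _ ⟨j', hj', rfl⟩
      simpa only [dist_eq_norm] using hj₀ j j' hj hj'
    exact hK.isComplete lam _ hc <| le_principal_iff.2 <| mem_map.2 <|
      Eventually.of_forall fun j => hS j lam h hh
  have hex : ∀ h, ∃ y, Tendsto (fun j => S j h) atTop (𝓝 y) := fun h => by
    obtain ⟨lam, hh⟩ := hH.exhaustive h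
    obtain ⟨y, -, hy⟩ := key lam h hh
    exact ⟨y, hy⟩
  choose f hf using hex
  refine ⟨linearMapOfTendsto f S (tendsto_pi_nhds.2 hf), fun lam h hh => ?_, hf⟩
  obtain ⟨y, hy, hlim⟩ := key lam h hh
  have hfy : f h = y := tendsto_nhds_unique (hf h) hlim
  change f h ∈ hK.E lam
  rwa [hfy]

/-- The adjoint of a locally bounded operator preserves the filtrations. -/
theorem IsLocallyBounded.adjoint_apply_mem {hH : LocallyHilbert Λ H} {hK : LocallyHilbert Λ K}
    {T : H →ₗ[ℂ] K} (hT : IsLocallyBounded hH hK T) {S : K →ₗ[ℂ] H} (hS : IsLAdjoint T S)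
    {lam : Λ} {k : K} (hk : k ∈ hK.E lam) : S k ∈ hH.E lam := by
  obtain ⟨v, hv, hTv⟩ := hT.adjoint_mem lam k hk
  have hSv : S k = v := ext_inner_left ℂ fun h => by rw [← hS h k, hTv h]
  rwa [hSv]

/-- The Hellinger–Toeplitz theorem: a linear map with a formal adjoint is bounded on every complete
subspace that it maps into a complete subspace. -/
theorem IsLAdjoint.exists_bound {T : H →ₗ[ℂ] K} {S : K →ₗ[ℂ] H} (hTS : IsLAdjoint T S)
    {p : Submodule ℂ H} {q : Submodule ℂ K} (hp : IsComplete (p : Set H))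
    (hq : IsComplete (q : Set K)) (hpq : ∀ h ∈ p, T h ∈ q) :
    ∃ C : ℝ, ∀ h ∈ p, ‖T h‖ ≤ C * ‖h‖ := by
  have : CompleteSpace p := hp.completeSpace_coe
  have : CompleteSpace q := hq.completeSpace_coe
  have hcont : Continuous (T.restrict hpq) := by
    refine LinearMap.continuous_of_seq_closed_graph _ fun u a b hu hTu => Subtype.ext ?_
    have hu' : Tendsto (fun n => (u n : H)) atTop (𝓝 a) :=
      (continuous_subtype_val.tendsto a).comp hu
    have hTu' : Tendsto (fun n => T (u n)) atTop (𝓝 b) :=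
      (continuous_subtype_val.tendsto b).comp hTu
    refine ext_inner_right ℂ fun k => ?_
    refine tendsto_nhds_unique (hTu'.inner tendsto_const_nhds) ?_
    simp only [LinearMap.coe_restrict_apply, hTS _ k]
    exact hu'.inner tendsto_const_nhds
  let R : p →L[ℂ] q := ⟨T.restrict hpq, hcont⟩
  exact ⟨‖R‖, fun h hh => R.le_opNorm ⟨h, hh⟩⟩

/-- A linear map preserving the filtrations with a formal adjoint preserving the filtrations is
locally bounded. -/
theorem IsLAdjoint.isLocallyBounded {hH : LocallyHilbert Λ H} {hK : LocallyHilbert Λ K}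
    {T : H →ₗ[ℂ] K} {S : K →ₗ[ℂ] H} (hTS : IsLAdjoint T S)
    (hT : ∀ lam, ∀ h ∈ hH.E lam, T h ∈ hK.E lam) (hS : ∀ lam, ∀ k ∈ hK.E lam, S k ∈ hH.E lam) :
    IsLocallyBounded hH hK T where
  maps_mem := hT
  bound lam := hTS.exists_bound (hH.isComplete lam) (hK.isComplete lam) (hT lam)
  adjoint_mem lam k hk := ⟨S k, hS lam k hk, fun h => hTS h k⟩

/-- Formal adjointness passes to pointwise limits. -/
theorem IsLAdjoint.of_tendsto {ι : Type*} {l : Filter ι} [l.NeBot] {Tn : ι → (H →ₗ[ℂ] K)}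
    {Sn : ι → (K →ₗ[ℂ] H)} {T : H →ₗ[ℂ] K} {S : K →ₗ[ℂ] H}
    (hTS : ∀ i, IsLAdjoint (Tn i) (Sn i)) (hT : ∀ h, Tendsto (fun i => Tn i h) l (𝓝 (T h)))
    (hS : ∀ k, Tendsto (fun i => Sn i k) l (𝓝 (S k))) : IsLAdjoint T S := by
  intro h k
  refine tendsto_nhds_unique ((hT h).inner tendsto_const_nhds) ?_
  simp only [hTS _ h k]
  exact tendsto_const_nhds.inner (hS k)

/-- `B_loc(H,K)` is complete for the strict topology: if `(T_j)` is a
net of locally bounded operators such that, for each `λ`, the nets `(T_j h)` (`h ∈ H_λ`)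
and `(T_j* k)` (`k ∈ K_λ`) are Cauchy, then there is a locally bounded `T` with
`T_j h → T h` and `T_j* k → T* k`. -/
theorem locallyBounded_strictly_complete
    {Λ : Type v} [PartialOrder Λ] [Nonempty Λ] [IsDirected Λ (· ≤ ·)]
    {H : Type u} [NormedAddCommGroup H] [InnerProductSpace ℂ H]
    {K : Type w} [NormedAddCommGroup K] [InnerProductSpace ℂ K]
    (hH : LocallyHilbert Λ H) (hK : LocallyHilbert Λ K)
    {J : Type x} [Preorder J] [Nonempty J] [IsDirected J (· ≤ ·)]
    (Tn : J → (H →ₗ[ℂ] K)) (Tnstar : J → (K →ₗ[ℂ] H))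
    (hTn : ∀ j : J, IsLocallyBounded hH hK (Tn j))
    (hTnstar : ∀ j : J, IsLAdjoint (Tn j) (Tnstar j))
    (hCauchy : ∀ lam : Λ, ∀ h ∈ hH.E lam, ∀ ε : ℝ, 0 < ε →
      ∃ j₀ : J, ∀ j j' : J, j₀ ≤ j → j₀ ≤ j' → ‖Tn j h - Tn j' h‖ < ε)
    (hCauchyStar : ∀ lam : Λ, ∀ k ∈ hK.E lam, ∀ ε : ℝ, 0 < ε →
      ∃ j₀ : J, ∀ j j' : J, j₀ ≤ j → j₀ ≤ j' → ‖Tnstar j k - Tnstar j' k‖ < ε) :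
    ∃ (T : H →ₗ[ℂ] K) (Tstar : K →ₗ[ℂ] H),
      IsLocallyBounded hH hK T ∧ IsLAdjoint T Tstar ∧
      (∀ lam : Λ, ∀ h ∈ hH.E lam, ∀ ε : ℝ, 0 < ε →
        ∃ j₀ : J, ∀ j : J, j₀ ≤ j → ‖Tn j h - T h‖ < ε) ∧
      (∀ lam : Λ, ∀ k ∈ hK.E lam, ∀ ε : ℝ, 0 < ε →
        ∃ j₀ : J, ∀ j : J, j₀ ≤ j → ‖Tnstar j k - Tstar k‖ < ε) := by
  obtain ⟨T, hT, hTlim⟩ :=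
    hH.exists_linearMap_tendsto hK Tn (fun j => (hTn j).maps_mem) hCauchy
  obtain ⟨S, hS, hSlim⟩ := hK.exists_linearMap_tendsto hH Tnstar
    (fun j _ _ hk => (hTn j).adjoint_apply_mem (hTnstar j) hk) hCauchyStar
  have hTS : IsLAdjoint T S := .of_tendsto hTnstar hTlim hSlim
  refine ⟨T, S, hTS.isLocallyBounded hT hS, hTS, fun _ h _ ε hε => ?_, fun _ k _ ε hε => ?_⟩
  · simpa only [dist_eq_norm] using eventually_atTop.1 (Metric.tendsto_nhds.1 (hTlim h) ε hε)
  · simpa only [dist_eq_norm] using eventually_atTop.1 (Metric.tendsto_nhds.1 (hSlim k) ε hε)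
end
end

section
/- Let A be a unital C*-algebra, H a complex Hilbert space, and φ : A → B(H) a linear map that is positive semidefinite, i.e., for every n and all a_1,…,a_n ∈ A, h_1,…,h_n ∈ H one has Σ_{i,j=1}^n ⟨φ(a_i* a_j) h_j, h_i⟩ ≥ 0. Then for every a ∈ A, every n, and all b_1,…,b_n ∈ A, h_1,…,h_n ∈ H: Σ_{i,j=1}^n ⟨φ(b_i* a* a b_j) h_j, h_i⟩ ≤ ‖a‖² · Σ_{i,j=1}^n ⟨φ(b_i* b_j) h_j, h_i⟩. -/
open scoped InnerProductSpace ComplexOrder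

/-- In a unital C⋆-algebra, `‖a‖² • 1 - a⋆a` is of the form `c⋆c`. -/
theorem exists_star_mul_self_eq_norm_sq_smul_one_sub {A : Type*} [CStarAlgebra A] (a : A) :
    ∃ c : A, star c * c = ((‖a‖ : ℂ) ^ 2) • (1 : A) - star a * a := by
  let : PartialOrder A := CStarAlgebra.spectralOrder A
  have : StarOrderedRing A := CStarAlgebra.spectralOrderedRing A
  obtain ⟨c, hc⟩ := CStarAlgebra.nonneg_iff_eq_star_mul_self.mp
    (sub_nonneg.mpr (CStarAlgebra.star_mul_le_algebraMap_norm_sq (a := a)))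
  refine ⟨c, hc.symm.trans ?_⟩
  rw [Algebra.algebraMap_eq_smul_one, ← Complex.ofReal_pow, Complex.coe_smul]

/-- If `A` is a unital C*-algebra, `H` a complex Hilbert space and
`φ : A → B(H)` a positive semidefinite linear map, then for every `a ∈ A`,
`Σ ⟨φ(b_i* a* a b_j) h_j, h_i⟩ ≤ ‖a‖² Σ ⟨φ(b_i* b_j) h_j, h_i⟩`. -/
theorem positive_semidefinite_map_szNagy_bound
    {A : Type*} [NormedRing A] [StarRing A] [CStarRing A]
    [NormedAlgebra ℂ A] [StarModule ℂ A] [CompleteSpace A]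
    {H : Type*} [NormedAddCommGroup H] [InnerProductSpace ℂ H] [CompleteSpace H]
    (φ : A →ₗ[ℂ] (H →L[ℂ] H))
    (hpos : ∀ (n : ℕ) (a : Fin n → A) (h : Fin n → H),
      0 ≤ ∑ i, ∑ j, ⟪h i, φ (star (a i) * a j) (h j)⟫_ℂ)
    (a : A) (n : ℕ) (b : Fin n → A) (h : Fin n → H) :
    ∑ i, ∑ j, ⟪h i, φ (star (b i) * star a * a * b j) (h j)⟫_ℂ
      ≤ (‖a‖ : ℂ) ^ 2 * ∑ i, ∑ j, ⟪h i, φ (star (b i) * b j) (h j)⟫_ℂ := by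
  let : CStarAlgebra A := { }
  obtain ⟨c, hc⟩ := exists_star_mul_self_eq_norm_sq_smul_one_sub a
  have key : ∀ i j, star (c * b i) * (c * b j) =
      ((‖a‖ : ℂ) ^ 2) • (star (b i) * b j) - star (b i) * star a * a * b j := by
    intro i j
    calc star (c * b i) * (c * b j) = star (b i) * (star c * c) * b j := by
          simp only [star_mul, mul_assoc]
      _ = _ := by
          rw [hc]
          simp only [mul_sub, sub_mul, mul_smul_comm, smul_mul_assoc, mul_one, mul_assoc]
  have hc_pos := hpos n (fun i => c * b i) h
  simp only [key, map_sub, map_smul, sub_apply,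
    smul_apply, inner_sub_right, inner_smul_right,
    Finset.sum_sub_distrib, ← Finset.mul_sum] at hc_pos
  exact sub_nonneg.mp hc_pos
end
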